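/- Let d = M/a_0 where a_0 = min_{x∈[0,1]} a(x), and let I_k = [λ_k − d, λ_k + d] for k ∈ ℕ. Let 𝒮 be the closure in ℝ × E of the set of nontrivial solutions (λ,u) of the problem (φ_p(u'))' + λ a(x) φ_p(u) + F(x,u,λ) = 0 on (0,1), u(0) = u(1) = 0, and let 𝒮_k^ν (ν ∈ {+,−}) be the subset of 𝒮 with u ∈ S_k^ν. Then for each k ∈ ℕ and each ν ∈ {+,−}, the connected component 𝒟_k^ν of 𝒮_k^ν ∪ (I_k × {0}) containing I_k × {0} is unbounded in ℝ × E and is contained in (ℝ × S_k^ν) ∪ (I_k × {0}). -/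

import Mathlib

open Set Filter Topology

/-- `φ_p(s) = |s|^{p-2} s`. -/
noncomputable def phip (p s : ℝ) : ℝ := |s| ^ (p - 2) * s

/-- membership in the space `E = {u ∈ C¹[0,1] : u 0 = u 1 = 0}`. -/
def MemE (u : ℝ → ℝ) : Prop := ContDiff ℝ 1 u ∧ u 0 = 0 ∧ u 1 = 0

/-- `u` is nontrivial on `[0,1]`. -/
def Nontriv (u : ℝ → ℝ) : Prop := ∃ x ∈ Set.Icc (0:ℝ) 1, u x ≠ 0

/-- `u ∈ S_k^ν` (ν = 1 or -1): u ∈ E, exactly k-1 interior zeros in (0,1), all zeros of u in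
[0,1] simple, and ν·u positive near 0. -/
def MemS (k : ℕ) (ν : ℝ) (u : ℝ → ℝ) : Prop :=
  MemE u ∧
  {x ∈ Ioo (0:ℝ) 1 | u x = 0}.Finite ∧
  {x ∈ Ioo (0:ℝ) 1 | u x = 0}.ncard = k - 1 ∧
  (∀ x ∈ Icc (0:ℝ) 1, u x = 0 → deriv u x ≠ 0) ∧
  ∃ δ > 0, ∀ x ∈ Ioo (0:ℝ) δ, 0 < ν * u x

/-- the `C¹` norm `‖u‖ = max_{[0,1]} |u| + max_{[0,1]} |u'|` of `E`. -/
noncomputable def normE (u : ℝ → ℝ) : ℝ :=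
  (⨆ x : Icc (0:ℝ) 1, |u x|) + (⨆ x : Icc (0:ℝ) 1, |deriv u x|)

/-- `u` solves the linear eigenvalue problem `-(φ_p(u'))' = λ a φ_p(u)` on (0,1), u(0)=u(1)=0. -/
def IsLinSol (p : ℝ) (a : ℝ → ℝ) (lam : ℝ) (u : ℝ → ℝ) : Prop :=
  MemE u ∧ ∀ x ∈ Set.Ioo (0:ℝ) 1,
    HasDerivAt (fun y => phip p (deriv u y)) (-(lam * a x * phip p (u x))) x

/-- the ambient space `ℝ × E`, with `E` embedded into `C[0,1] × C[0,1]` via `u ↦ (u, u')`. -/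
abbrev CI := ContinuousMap (Set.Icc (0:ℝ) 1) ℝ

abbrev Xsp := ℝ × CI × CI

/-- `w` represents the element `u` of `E` (i.e. `w = (u|_{[0,1]}, u'|_{[0,1]})`). -/
def ReprE (u : ℝ → ℝ) (w : CI × CI) : Prop :=
  (∀ x : Set.Icc (0:ℝ) 1, w.1 x = u x) ∧ (∀ x : Set.Icc (0:ℝ) 1, w.2 x = deriv u x)

/-- `u` solves `(φ_p(u'))' + λ a φ_p(u) + f(x,u,λ) + g(x,u,λ) = 0` on (0,1), u(0)=u(1)=0. -/
def IsSolFG (p : ℝ) (a : ℝ → ℝ) (f g : ℝ → ℝ → ℝ → ℝ) (lam : ℝ) (u : ℝ → ℝ) : Prop :=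
  MemE u ∧ ∀ x ∈ Set.Ioo (0:ℝ) 1,
    HasDerivAt (fun y => phip p (deriv u y))
      (-(lam * a x * phip p (u x) + f x (u x) lam + g x (u x) lam)) x

section PhipLemmas

variable {p : ℝ}

@[simp] lemma phip_zero (p : ℝ) : phip p 0 = 0 := by simp [phip]

@[simp] lemma phip_neg (p s : ℝ) : phip p (-s) = -phip p s := by simp [phip]

lemma abs_phip (hp : 1 < p) (s : ℝ) : |phip p s| = |s| ^ (p - 1) := by
  rcases eq_or_ne s 0 with rfl | hs
  · simp [Real.zero_rpow (by linarith : p - 1 ≠ 0)]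
  · have : 0 < |s| := abs_pos.2 hs
    rw [phip, abs_mul, abs_of_nonneg (by positivity), ← Real.rpow_add_one this.ne']
    congr 1; ring

lemma phip_mul (p s t : ℝ) : phip p (s * t) = phip p s * phip p t := by
  simp only [phip, abs_mul, Real.mul_rpow (abs_nonneg s) (abs_nonneg t)]; ring

lemma phip_mul_self (hp : 1 < p) (s : ℝ) : phip p s * s = |s| ^ p := by
  rcases eq_or_ne s 0 with rfl | hs
  · simp [Real.zero_rpow (by linarith : p ≠ 0)]
  · have h : 0 < |s| := abs_pos.2 hs
    rw [phip, mul_assoc, ← sq, ← sq_abs, ← Real.rpow_natCast, ← Real.rpow_add h]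
    congr 1; push_cast; ring

lemma phip_pos_iff {s : ℝ} : 0 < phip p s ↔ 0 < s := by
  rcases eq_or_ne s 0 with rfl | hs
  · simp
  · have h : 0 < |s| ^ (p - 2) := Real.rpow_pos_of_pos (abs_pos.2 hs) _
    exact mul_pos_iff_of_pos_left h

lemma phip_eq_zero_iff {s : ℝ} : phip p s = 0 ↔ s = 0 := by
  refine ⟨fun h => ?_, fun h => by simp [h]⟩
  by_contra hs
  exact mul_ne_zero (Real.rpow_pos_of_pos (abs_pos.2 hs) _).ne' hs h

lemma continuous_phip (hp : 1 < p) : Continuous (phip p) := by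
  rw [continuous_iff_continuousAt]
  intro s
  rcases eq_or_ne s 0 with rfl | hs
  · rw [ContinuousAt, phip_zero, tendsto_zero_iff_abs_tendsto_zero]
    have h1 : (abs ∘ phip p) = fun s => |s| ^ (p - 1) := funext fun s => abs_phip hp s
    rw [h1]
    have : Continuous fun s : ℝ => |s| ^ (p - 1) :=
      continuous_abs.rpow_const fun _ => Or.inr (by linarith)
    simpa [Real.zero_rpow (by linarith : p - 1 ≠ 0)] using this.tendsto 0
  · exact (continuous_abs.continuousAt.rpow_const (Or.inl (abs_ne_zero.2 hs))).mul continuousAt_id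

lemma hasDerivAt_phip {s : ℝ} (hs : s ≠ 0) :
    HasDerivAt (phip p) ((p - 1) * |s| ^ (p - 2)) s := by
  have h := abs_pos.2 hs
  have h1 : HasDerivAt (fun x : ℝ => |x| ^ (p - 2)) ((SignType.sign s : ℝ) * (p - 2) * |s| ^ (p - 2 - 1)) s :=
    (hasDerivAt_abs hs).rpow_const (Or.inl h.ne')
  have h2 := h1.mul (hasDerivAt_id s)
  refine h2.congr_deriv ?_
  have h3 : |s| ^ (p - 2) = |s| ^ (p - 2 - 1) * |s| := by
    rw [← Real.rpow_add_one h.ne']; congr 1; ring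
  simp only [id, mul_one]
  rw [h3]
  have h4 : (SignType.sign s : ℝ) * s = |s| := sign_mul_self s
  linear_combination (p - 2) * |s| ^ (p - 2 - 1) * h4

lemma hasDerivAt_abs_rpow_phip (hp : 1 < p) (s : ℝ) :
    HasDerivAt (fun x : ℝ => |x| ^ p) (p * phip p s) s := by
  simpa [phip, mul_assoc] using hasDerivAt_abs_rpow s hp

lemma phip_phip_conj (hp : 1 < p) (s : ℝ) : phip (p / (p - 1)) (phip p s) = s := by
  rcases eq_or_ne s 0 with rfl | hs
  · simp
  have h := abs_pos.2 hs
  have hp' : p - 1 ≠ 0 := by linarith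
  have : phip (p / (p - 1)) (phip p s) = (|s| ^ (p - 1)) ^ (p / (p - 1) - 2) * phip p s := by
    rw [← abs_phip hp]; rfl
  rw [this, phip, ← Real.rpow_mul h.le, ← mul_assoc, ← Real.rpow_add h]
  have : (p - 1) * (p / (p - 1) - 2) + (p - 2) = 0 := by field_simp; ring
  rw [this, Real.rpow_zero, one_mul]

lemma one_lt_conj (hp : 1 < p) : 1 < p / (p - 1) := by
  rw [lt_div_iff₀] <;> linarith

lemma phip_conj_phip (hp : 1 < p) (s : ℝ) : phip p (phip (p / (p - 1)) s) = s := by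
  have h := phip_phip_conj (one_lt_conj hp) s
  have hp' : p - 1 ≠ 0 := by linarith
  have : p / (p - 1) / (p / (p - 1) - 1) = p := by field_simp; ring
  rwa [this] at h

lemma phip_ne_zero {s : ℝ} (hs : s ≠ 0) : phip p s ≠ 0 := fun h => hs (phip_eq_zero_iff.1 h)

lemma phip_div (p s t : ℝ) (ht : t ≠ 0) : phip p (s / t) = phip p s / phip p t := by
  rw [eq_div_iff (phip_ne_zero ht), ← phip_mul, div_mul_cancel₀ _ ht]

end PhipLemmas

section Rotation

/-- `θ` is a continuous determination of the argument of `γ`. -/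
def IsArgLift {X : Type*} [TopologicalSpace X] (γ : C(X, ℂ)) (θ : C(X, ℝ)) : Prop :=
  ∀ x, γ x = ‖γ x‖ * Complex.exp (θ x * Complex.I)

lemma exists_isArgLift {X : Type*} [TopologicalSpace X] [SimplyConnectedSpace X]
    [LocallyPathConnectedSpace X] (γ : C(X, ℂ)) (hγ : ∀ x, γ x ≠ 0) (x₀ : X) :
    ∃ θ : C(X, ℝ), θ x₀ = (γ x₀).arg ∧ IsArgLift γ θ := by
  obtain ⟨F, ⟨hF0, hF⟩, -⟩ := Complex.isCoveringMapOn_exp.existsUnique_continuousMap_lifts γ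
    (a₀ := x₀) (Complex.exp_log (hγ x₀)) (fun x => hγ x)
  refine ⟨⟨fun x => (F x).im, by fun_prop⟩, ?_, fun x => ?_⟩
  · simp [hF0, Complex.log_im]
  · have h : Complex.exp (F x) = γ x := congrFun hF x
    have h2 : ‖γ x‖ = Real.exp (F x).re := by rw [← h, Complex.norm_exp]
    rw [h2, ← h, Complex.ofReal_exp, ← Complex.exp_add]
    congr 1
    exact (Complex.re_add_im (F x)).symm

lemma exists_isArgLift_Icc (γ : C(Icc (0:ℝ) 1, ℂ)) (hγ : ∀ x, γ x ≠ 0) :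
    ∃ θ : C(Icc (0:ℝ) 1, ℝ), IsArgLift γ θ := by
  let e : C(ℝ, Icc (0:ℝ) 1) := ⟨projIcc 0 1 zero_le_one, continuous_projIcc⟩
  obtain ⟨θ, -, h⟩ := exists_isArgLift (γ.comp e) (fun x => hγ _) 0
  refine ⟨θ.comp ⟨Subtype.val, continuous_subtype_val⟩, fun x => ?_⟩
  have := h x
  simpa [e] using this

lemma IsArgLift.sub_const {X : Type*} [TopologicalSpace X] [PreconnectedSpace X] {γ : C(X, ℂ)}
    (hγ : ∀ x, γ x ≠ 0) {θ θ' : C(X, ℝ)} (h : IsArgLift γ θ) (h' : IsArgLift γ θ') (x y : X) :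
    θ x - θ' x = θ y - θ' y := by
  have key : ∀ x, θ x - θ' x ∈ (AddSubgroup.zmultiples (2 * Real.pi) : Set ℝ) := fun x => by
    have h1 : (‖γ x‖ : ℂ) * Complex.exp (θ x * Complex.I) = ‖γ x‖ * Complex.exp (θ' x * Complex.I) :=
      (h x).symm.trans (h' x)
    have h2 := mul_left_cancel₀ (by simpa using hγ x) h1
    obtain ⟨n, hn⟩ := Complex.exp_eq_exp_iff_exists_int.1 h2
    refine ⟨n, ?_⟩
    have := congrArg Complex.im hn
    simp at this
    simp; linarith
  have : DiscreteTopology (AddSubgroup.zmultiples (2 * Real.pi) : Set ℝ) :=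
    inferInstanceAs (DiscreteTopology (AddSubgroup.zmultiples (2 * Real.pi)))
  exact isPreconnected_univ.constant_of_mapsTo (f := fun x => θ x - θ' x)
    (T := (AddSubgroup.zmultiples (2 * Real.pi) : Set ℝ))
    ⟨this⟩ (by fun_prop) (fun x _ => key x) (mem_univ x) (mem_univ y)

open Classical in
/-- total variation of the argument along a nowhere vanishing path in `ℂ`. -/
noncomputable def rotAngle (γ : C(Icc (0:ℝ) 1, ℂ)) : ℝ :=
  if h : ∃ θ : C(Icc (0:ℝ) 1, ℝ), IsArgLift γ θ then
    h.choose ⟨1, by simp⟩ - h.choose ⟨0, by simp⟩ else 0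

lemma IsArgLift.rotAngle_eq {γ : C(Icc (0:ℝ) 1, ℂ)} (hγ : ∀ x, γ x ≠ 0) {θ : C(Icc (0:ℝ) 1, ℝ)}
    (h : IsArgLift γ θ) : rotAngle γ = θ ⟨1, by simp⟩ - θ ⟨0, by simp⟩ := by
  have h0 : ∃ θ : C(Icc (0:ℝ) 1, ℝ), IsArgLift γ θ := ⟨θ, h⟩
  rw [rotAngle, dif_pos h0]
  have := IsArgLift.sub_const hγ h0.choose_spec h ⟨0, by simp⟩ ⟨1, by simp⟩
  linarith

lemma continuousAt_rotAngle {γ : C(Icc (0:ℝ) 1, ℂ)} (hγ : ∀ x, γ x ≠ 0) :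
    ContinuousAt rotAngle γ := by
  obtain ⟨θ, hθ⟩ := exists_isArgLift_Icc γ hγ
  obtain ⟨m, hm0, hm⟩ : ∃ m > 0, ∀ x, m ≤ ‖γ x‖ := by
    obtain ⟨x, -, hx⟩ := isCompact_univ.exists_isMinOn (univ_nonempty (α := Icc (0:ℝ) 1))
      (f := fun x => ‖γ x‖) (by fun_prop)
    exact ⟨‖γ x‖, norm_pos_iff.2 (hγ x), fun y => hx (mem_univ y)⟩
  have hev : rotAngle =ᶠ[𝓝 γ] fun γ' => rotAngle γ +
      ((γ' ⟨1, by simp⟩ / γ ⟨1, by simp⟩).arg - (γ' ⟨0, by simp⟩ / γ ⟨0, by simp⟩).arg) := by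
    filter_upwards [Metric.ball_mem_nhds γ hm0] with γ' hγ'
    have hslit : ∀ x, γ' x / γ x ∈ Complex.slitPlane := fun x => by
      have h1 : ‖γ' x - γ x‖ < ‖γ x‖ := by
        rw [← dist_eq_norm]
        exact (ContinuousMap.dist_apply_le_dist x).trans_lt (hγ'.trans_le (hm x))
      have h2 : γ' x / γ x = 1 + (γ' x - γ x) / γ x := by field_simp [hγ x]; ring
      rw [h2]
      refine Complex.mem_slitPlane_of_norm_lt_one ?_
      rw [norm_div, div_lt_one (norm_pos_iff.2 (hγ x))]; exact h1
    let η : C(Icc (0:ℝ) 1, ℝ) := ⟨fun x => θ x + (γ' x / γ x).arg, by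
      refine θ.continuous.add (continuous_iff_continuousAt.2 fun x => ?_)
      exact ContinuousAt.comp (f := fun x => γ' x / γ x) (g := Complex.arg)
        (Complex.continuousAt_arg (hslit x))
        (γ'.continuous.continuousAt.div γ.continuous.continuousAt (hγ x))⟩
    have hη : IsArgLift γ' η := fun x => by
      have h1 := Complex.norm_mul_exp_arg_mul_I (γ' x / γ x)
      have h2 : γ' x = γ x * (γ' x / γ x) := by field_simp [hγ x]
      have hn : (‖γ' x‖ : ℂ) = ‖γ x‖ * ‖γ' x / γ x‖ := by
        rw [norm_div]; push_cast
        have : (‖γ x‖ : ℂ) ≠ 0 := by simpa using hγ x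
        field_simp
      have h3 : Complex.exp (η x * Complex.I) =
          Complex.exp (θ x * Complex.I) * Complex.exp ((γ' x / γ x).arg * Complex.I) := by
        rw [← Complex.exp_add, ← add_mul]; simp [η]
      rw [hn, h3]
      calc γ' x = γ x * (γ' x / γ x) := h2
        _ = (‖γ x‖ * Complex.exp (θ x * Complex.I)) *
            (‖γ' x / γ x‖ * Complex.exp ((γ' x / γ x).arg * Complex.I)) := by
            rw [← hθ x, h1]
        _ = _ := by ring
    have hγ'0 : ∀ x, γ' x ≠ 0 := fun x h => by
      have := Complex.slitPlane_ne_zero (hslit x); simp [h] at this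
    rw [hη.rotAngle_eq hγ'0, hθ.rotAngle_eq hγ]
    simp only [η, ContinuousMap.coe_mk]; ring
  refine ContinuousAt.congr ?_ hev.symm
  have hpt : ∀ x : Icc (0:ℝ) 1, ContinuousAt (fun γ' : C(Icc (0:ℝ) 1, ℂ) => (γ' x / γ x).arg) γ :=
    fun x => by
      refine ContinuousAt.comp (f := fun γ' : C(Icc (0:ℝ) 1, ℂ) => γ' x / γ x) (g := Complex.arg)
        (Complex.continuousAt_arg ?_) ?_
      · simp [hγ x]
      · exact (continuous_eval_const x).continuousAt.div_const _
  exact continuousAt_const.add ((hpt _).sub (hpt _))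

end Rotation

section PlanarZero

lemma abs_sub_lt_of_cos_pos {X : Type*} [TopologicalSpace X] {s : Set X} (hs : IsPreconnected s)
    (θ : C(X, ℝ)) (β : ℝ) (hcos : ∀ x ∈ s, 0 < Real.cos (θ x - β)) {x₀ : X} (hx₀ : x₀ ∈ s)
    (h₀ : |θ x₀ - β| < Real.pi / 2) : ∀ x ∈ s, |θ x - β| < Real.pi / 2 := by
  intro x hx
  have hoc : (θ '' s).OrdConnected := (hs.image θ θ.continuous.continuousOn).ordConnected
  rw [abs_lt] at h₀ ⊢
  constructor
  · by_contra! hcon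
    obtain ⟨y, hy, hyx⟩ := hoc.out (mem_image_of_mem θ hx) (mem_image_of_mem θ hx₀)
      (show β - Real.pi / 2 ∈ Icc _ _ from ⟨by linarith, by linarith⟩)
    have := hcos y hy
    rw [hyx, show β - Real.pi / 2 - β = -(Real.pi / 2) by ring, Real.cos_neg,
      Real.cos_pi_div_two] at this
    exact lt_irrefl _ this
  · by_contra! hcon
    obtain ⟨y, hy, hyx⟩ := hoc.out (mem_image_of_mem θ hx₀) (mem_image_of_mem θ hx)
      (show β + Real.pi / 2 ∈ Icc _ _ from ⟨by linarith, by linarith⟩)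
    have := hcos y hy
    rw [hyx, show β + Real.pi / 2 - β = Real.pi / 2 by ring, Real.cos_pi_div_two] at this
    exact lt_irrefl _ this

lemma exists_common_zero_rect {h ψ : ℝ × ℝ → ℝ} {a m₁ m₂ b c d : ℝ} (h1 : a ≤ m₁) (h2 : m₁ ≤ m₂)
    (h3 : m₂ ≤ b) (hcd : c ≤ d) (hh : ContinuousOn h (Icc a b ×ˢ Icc c d))
    (hψ : ContinuousOn ψ (Icc a b ×ˢ Icc c d))
    (left : ∀ y ∈ Icc c d, 0 < ψ (a, y)) (right : ∀ y ∈ Icc c d, 0 < ψ (b, y))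
    (top : ∀ x ∈ Icc a b, 0 < ψ (x, d)) (bot₁ : ∀ x ∈ Icc a m₁, h (x, c) < 0)
    (bot₂ : ∀ x ∈ Icc m₁ m₂, ψ (x, c) < 0) (bot₃ : ∀ x ∈ Icc m₂ b, 0 < h (x, c)) :
    ∃ z ∈ Icc a b ×ˢ Icc c d, h z = 0 ∧ ψ z = 0 := by
  by_contra! hne
  have hab : a ≤ b := by linarith
  let cl : ℝ × ℝ → ℝ × ℝ := fun z => ((projIcc a b hab z.1 : ℝ), (projIcc c d hcd z.2 : ℝ))
  have hcl : Continuous cl := by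
    refine Continuous.prodMk ?_ ?_
    · exact continuous_subtype_val.comp (continuous_projIcc.comp continuous_fst)
    · exact continuous_subtype_val.comp (continuous_projIcc.comp continuous_snd)
  have hclm : ∀ z, cl z ∈ Icc a b ×ˢ Icc c d := fun z => ⟨Subtype.prop _, Subtype.prop _⟩
  have hcle : ∀ x ∈ Icc a b, ∀ y ∈ Icc c d, cl (x, y) = (x, y) := fun x hx y hy => by
    simp only [cl, projIcc_of_mem hab hx, projIcc_of_mem hcd hy]
  let f : C(ℝ × ℝ, ℂ) := ⟨fun z => (h (cl z) : ℂ) + ψ (cl z) * Complex.I, by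
    have e1 : Continuous fun z => h (cl z) := hh.comp_continuous hcl hclm
    have e2 : Continuous fun z => ψ (cl z) := hψ.comp_continuous hcl hclm
    exact (Complex.continuous_ofReal.comp e1).add
      ((Complex.continuous_ofReal.comp e2).mul continuous_const)⟩
  have hre : ∀ z, (f z).re = h (cl z) := fun z => by simp [f]
  have him : ∀ z, (f z).im = ψ (cl z) := fun z => by simp [f]
  have hf0 : ∀ z, f z ≠ 0 := fun z hz => by
    refine hne (cl z) (hclm z) ?_ ?_
    · rw [← hre, hz]; rfl
    · rw [← him, hz]; rfl
  obtain ⟨θ, hθ0, hθ⟩ := exists_isArgLift f hf0 (a, c)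
  have hpos : ∀ z, 0 < ‖f z‖ := fun z => norm_pos_iff.2 (hf0 z)
  have hcos : ∀ z, h (cl z) = ‖f z‖ * Real.cos (θ z) := fun z => by
    rw [← hre z]; conv_lhs => rw [hθ z]
    rw [Complex.re_ofReal_mul, Complex.exp_ofReal_mul_I_re]
  have hsin : ∀ z, ψ (cl z) = ‖f z‖ * Real.sin (θ z) := fun z => by
    rw [← him z]; conv_lhs => rw [hθ z]
    rw [Complex.im_ofReal_mul, Complex.exp_ofReal_mul_I_im]
  have ma : a ∈ Icc a b := ⟨le_rfl, hab⟩
  have mb : b ∈ Icc a b := ⟨hab, le_rfl⟩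
  have mc : c ∈ Icc c d := ⟨le_rfl, hcd⟩
  have md : d ∈ Icc c d := ⟨hcd, le_rfl⟩
  have hpi := Real.pi_pos
  have psiPos : ∀ x ∈ Icc a b, ∀ y ∈ Icc c d, 0 < ψ (x, y) →
      0 < Real.cos (θ (x, y) - Real.pi / 2) := fun x hx y hy hp => by
    rw [Real.cos_sub_pi_div_two]
    rw [← hcle x hx y hy, hsin] at hp
    exact pos_of_mul_pos_right hp (hpos _).le
  have psiNeg : ∀ x ∈ Icc a b, ∀ y ∈ Icc c d, ψ (x, y) < 0 →
      0 < Real.cos (θ (x, y) - 3 * Real.pi / 2) := fun x hx y hy hp => by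
    have : Real.cos (θ (x, y) - 3 * Real.pi / 2) = - Real.sin (θ (x, y)) := by
      rw [show θ (x, y) - 3 * Real.pi / 2 = θ (x, y) - Real.pi / 2 - Real.pi by ring,
        Real.cos_sub_pi, Real.cos_sub_pi_div_two]
    rw [this]
    rw [← hcle x hx y hy, hsin] at hp
    have := neg_of_mul_neg_right hp (hpos _).le
    linarith
  have hNeg : ∀ x ∈ Icc a b, ∀ y ∈ Icc c d, h (x, y) < 0 →
      0 < Real.cos (θ (x, y) - Real.pi) := fun x hx y hy hp => by
    rw [Real.cos_sub_pi]
    rw [← hcle x hx y hy, hcos] at hp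
    have := neg_of_mul_neg_right hp (hpos _).le
    linarith
  have hPos : ∀ x ∈ Icc a b, ∀ y ∈ Icc c d, 0 < h (x, y) →
      0 < Real.cos (θ (x, y) - 2 * Real.pi) := fun x hx y hy hp => by
    rw [Real.cos_sub_two_pi]
    rw [← hcle x hx y hy, hcos] at hp
    exact pos_of_mul_pos_right hp (hpos _).le
  have hpc : ∀ {x1 x2 y1 y2 : ℝ}, IsPreconnected (Icc x1 x2 ×ˢ Icc y1 y2 : Set (ℝ × ℝ)) :=
    isPreconnected_Icc.prod isPreconnected_Icc
  -- the starting corner lies in the open second quadrant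
  have hstart : Real.pi / 2 < θ (a, c) ∧ θ (a, c) < Real.pi := by
    have hi : 0 < (f (a, c)).im := by rw [him, hcle a ma c mc]; exact left c mc
    have hr : (f (a, c)).re < 0 := by rw [hre, hcle a ma c mc]; exact bot₁ a ⟨le_rfl, h1⟩
    rw [hθ0]
    constructor
    · by_contra! hcon
      have := Complex.abs_arg_le_pi_div_two_iff.1 (abs_le.2 ⟨by
        have := Complex.arg_nonneg_iff.2 hi.le; linarith, hcon⟩)
      linarith
    · exact Complex.arg_lt_pi_iff.2 (Or.inr hi.ne')
  have L := abs_sub_lt_of_cos_pos (hpc (x1 := a) (x2 := a) (y1 := c) (y2 := d)) θ (Real.pi / 2)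
    (fun z hz => by
      obtain ⟨x, y⟩ := z
      obtain rfl : x = a := le_antisymm hz.1.2 hz.1.1
      exact psiPos x ma y hz.2 (left y hz.2)) (x₀ := (a, c)) ⟨⟨le_rfl, le_rfl⟩, mc⟩
    (by rw [abs_lt]; constructor <;> linarith) (a, d) ⟨⟨le_rfl, le_rfl⟩, md⟩
  have T := abs_sub_lt_of_cos_pos (hpc (x1 := a) (x2 := b) (y1 := d) (y2 := d)) θ (Real.pi / 2)
    (fun z hz => by
      obtain ⟨x, y⟩ := z
      obtain rfl : y = d := le_antisymm hz.2.2 hz.2.1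
      exact psiPos x hz.1 y md (top x hz.1)) (x₀ := (a, d)) ⟨ma, ⟨le_rfl, le_rfl⟩⟩
    L (b, d) ⟨mb, ⟨le_rfl, le_rfl⟩⟩
  have R := abs_sub_lt_of_cos_pos (hpc (x1 := b) (x2 := b) (y1 := c) (y2 := d)) θ (Real.pi / 2)
    (fun z hz => by
      obtain ⟨x, y⟩ := z
      obtain rfl : x = b := le_antisymm hz.1.2 hz.1.1
      exact psiPos x mb y hz.2 (right y hz.2)) (x₀ := (b, d)) ⟨⟨le_rfl, le_rfl⟩, md⟩
    T (b, c) ⟨⟨le_rfl, le_rfl⟩, mc⟩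
  have B1 := abs_sub_lt_of_cos_pos (hpc (x1 := a) (x2 := m₁) (y1 := c) (y2 := c)) θ Real.pi
    (fun z hz => by
      obtain ⟨x, y⟩ := z
      obtain rfl : y = c := le_antisymm hz.2.2 hz.2.1
      exact hNeg x ⟨hz.1.1, by linarith [hz.1.2]⟩ y mc (bot₁ x hz.1)) (x₀ := (a, c))
    ⟨⟨le_rfl, h1⟩, ⟨le_rfl, le_rfl⟩⟩
    (by rw [abs_lt]; constructor <;> linarith) (m₁, c) ⟨⟨h1, le_rfl⟩, ⟨le_rfl, le_rfl⟩⟩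
  have mm1 : m₁ ∈ Icc a b := ⟨h1, by linarith⟩
  have mm2 : m₂ ∈ Icc a b := ⟨by linarith, h3⟩
  have B2 : Real.pi < θ (m₁, c) ∧ θ (m₁, c) < 2 * Real.pi := by
    have hneg := bot₂ m₁ ⟨le_rfl, h2⟩
    rw [← hcle m₁ mm1 c mc, hsin] at hneg
    have hs := neg_of_mul_neg_right hneg (hpos _).le
    rw [abs_lt] at B1
    refine ⟨?_, by linarith⟩
    by_contra! hcon
    have := Real.sin_nonneg_of_nonneg_of_le_pi (x := θ (m₁, c)) (by linarith) hcon
    linarith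
  have B3 := abs_sub_lt_of_cos_pos (hpc (x1 := m₁) (x2 := m₂) (y1 := c) (y2 := c)) θ
    (3 * Real.pi / 2)
    (fun z hz => by
      obtain ⟨x, y⟩ := z
      obtain rfl : y = c := le_antisymm hz.2.2 hz.2.1
      exact psiNeg x ⟨by linarith [hz.1.1], by linarith [hz.1.2]⟩ y mc (bot₂ x hz.1))
    (x₀ := (m₁, c)) ⟨⟨le_rfl, h2⟩, ⟨le_rfl, le_rfl⟩⟩
    (by rw [abs_lt]; constructor <;> linarith) (m₂, c) ⟨⟨h2, le_rfl⟩, ⟨le_rfl, le_rfl⟩⟩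
  have B4 : 3 * Real.pi / 2 < θ (m₂, c) := by
    have hp := bot₃ m₂ ⟨le_rfl, h3⟩
    rw [← hcle m₂ mm2 c mc, hcos] at hp
    have hs := pos_of_mul_pos_right hp (hpos _).le
    rw [abs_lt] at B3
    by_contra! hcon
    have : Real.cos (θ (m₂, c)) ≤ 0 :=
      Real.cos_nonpos_of_pi_div_two_le_of_le (by linarith) (by linarith)
    linarith
  have B5 := abs_sub_lt_of_cos_pos (hpc (x1 := m₂) (x2 := b) (y1 := c) (y2 := c)) θ
    (2 * Real.pi)
    (fun z hz => by
      obtain ⟨x, y⟩ := z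
      obtain rfl : y = c := le_antisymm hz.2.2 hz.2.1
      exact hPos x ⟨by linarith [hz.1.1], by linarith [hz.1.2]⟩ y mc (bot₃ x hz.1))
    (x₀ := (m₂, c)) ⟨⟨le_rfl, h3⟩, ⟨le_rfl, le_rfl⟩⟩
    (by rw [abs_lt] at B3 ⊢; constructor <;> linarith) (b, c) ⟨⟨h3, le_rfl⟩, ⟨le_rfl, le_rfl⟩⟩
  rw [abs_lt] at R B5
  linarith

end PlanarZero

section PhaseAngle

lemma eventually_sign_of_hasDerivAt_pos {f : ℝ → ℝ} {f' s : ℝ} (h : HasDerivAt f f' s)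
    (hf' : 0 < f') (hs : f s = 0) : ∀ᶠ x in 𝓝 s, (s < x → 0 < f x) ∧ (x < s → f x < 0) := by
  have hd : 0 < deriv f s := by rwa [h.deriv]
  filter_upwards [eventually_nhdsWithin_sign_eq_of_deriv_pos hd hs] with x hx
  constructor
  · intro hlt
    rw [sign_pos (sub_pos.2 hlt)] at hx
    exact sign_eq_one_iff.1 hx
  · intro hlt
    rw [sign_neg (sub_neg.2 hlt)] at hx
    exact sign_eq_neg_one_iff.1 hx

/-- `θ` is a continuous phase angle of `u` on `[0,1]`: it starts at `0`, is a multiple of `π`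
precisely at the zeros of `u`, and crosses these multiples only upwards. -/
structure IsPhaseAngle (u θ : ℝ → ℝ) : Prop where
  cont : ContinuousOn θ (Icc 0 1)
  zero : θ 0 = 0
  zeros : ∀ x ∈ Icc (0:ℝ) 1, u x = 0 ↔ ∃ m : ℤ, θ x = m * Real.pi
  up : ∀ x ∈ Icc (0:ℝ) 1, ∀ y ∈ Icc (0:ℝ) 1, x < y → ∀ m : ℤ, m * Real.pi ≤ θ x → m * Real.pi < θ y

/-- the path `x ↦ (φ_p(u'(x)), u(x))` in the phase plane, for `w = (u, u')`. -/
noncomputable def phaseCurve {p : ℝ} (hp : 1 < p) (w : CI × CI) : C(Icc (0:ℝ) 1, ℂ) :=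
  ⟨fun x => (phip p (w.2 x) : ℂ) + w.1 x * Complex.I, by
    have := (continuous_phip hp).comp w.2.continuous
    exact (Complex.continuous_ofReal.comp this).add
      ((Complex.continuous_ofReal.comp w.1.continuous).mul continuous_const)⟩

lemma phaseCurve_re {p : ℝ} (hp : 1 < p) (w : CI × CI) (x) :
    (phaseCurve hp w x).re = phip p (w.2 x) := by simp [phaseCurve]

lemma phaseCurve_im {p : ℝ} (hp : 1 < p) (w : CI × CI) (x) :
    (phaseCurve hp w x).im = w.1 x := by simp [phaseCurve]

lemma phaseCurve_ne_zero_iff {p : ℝ} (hp : 1 < p) (w : CI × CI) (x) :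
    phaseCurve hp w x ≠ 0 ↔ (w.1 x = 0 → w.2 x ≠ 0) := by
  rw [Ne, Complex.ext_iff, phaseCurve_re, phaseCurve_im]
  simp only [Complex.zero_re, Complex.zero_im, phip_eq_zero_iff]
  tauto

lemma continuous_phaseCurve {p : ℝ} (hp : 1 < p) : Continuous (phaseCurve hp) := by
  refine ContinuousMap.continuous_of_continuous_uncurry _ ?_
  have h1 : Continuous fun q : (CI × CI) × Icc (0:ℝ) 1 => q.1.1 q.2 := by fun_prop
  have h2 : Continuous fun q : (CI × CI) × Icc (0:ℝ) 1 => q.1.2 q.2 := by fun_prop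
  exact (Complex.continuous_ofReal.comp ((continuous_phip hp).comp h2)).add
      ((Complex.continuous_ofReal.comp h1).mul continuous_const)

/-- A continuous angle that moves strictly upwards through a level cannot come back to it. -/
lemma lt_of_crossing {Θ : ℝ → ℝ} (hΘ : Continuous Θ) {c x y : ℝ} (hxy : x < y)
    (hcross : ∀ s ∈ Icc x y, Θ s = c →
      ∀ᶠ t in 𝓝 s, t ∈ Icc x y → (s < t → c < Θ t) ∧ (t < s → Θ t < c))
    (hx : c ≤ Θ x) : c < Θ y := by
  by_contra! hy
  have hfr : ∀ {a b : ℝ}, a < b → ∀ {P : ℝ → Prop}, (∀ᶠ t in 𝓝 b, P t) →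
      ∃ t, a < t ∧ t < b ∧ P t := fun {a b} hab {P} hP => by
    have h1 : ∀ᶠ t in 𝓝[<] b, P t := hP.filter_mono nhdsWithin_le_nhds
    obtain ⟨t, ht, ht'⟩ := (h1.and (Ioo_mem_nhdsLT hab)).exists
    exact ⟨t, ht'.1, ht'.2, ht⟩
  have hfr' : ∀ {a b : ℝ}, a < b → ∀ {P : ℝ → Prop}, (∀ᶠ t in 𝓝 a, P t) →
      ∃ t, a < t ∧ t < b ∧ P t := fun {a b} hab {P} hP => by
    have h1 : ∀ᶠ t in 𝓝[>] a, P t := hP.filter_mono nhdsWithin_le_nhds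
    obtain ⟨t, ht, ht'⟩ := (h1.and (Ioo_mem_nhdsGT hab)).exists
    exact ⟨t, ht'.1, ht'.2, ht⟩
  obtain ⟨y', hxy', hy'y, hy'⟩ : ∃ y', x < y' ∧ y' ≤ y ∧ Θ y' < c := by
    rcases hy.lt_or_eq with h | h
    · exact ⟨y, hxy, le_rfl, h⟩
    · obtain ⟨t, h1, h2, h3⟩ := hfr hxy (hcross y ⟨hxy.le, le_rfl⟩ h)
      exact ⟨t, h1, h2.le, (h3 ⟨h1.le, h2.le⟩).2 h2⟩
  have hS : IsCompact (Icc x y' ∩ Θ ⁻¹' {c}) :=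
    isCompact_Icc.inter_right (isClosed_singleton.preimage hΘ)
  have hSn : (Icc x y' ∩ Θ ⁻¹' {c}).Nonempty := by
    obtain ⟨s, hs, hs'⟩ := intermediate_value_Icc' hxy'.le hΘ.continuousOn ⟨hy'.le, hx⟩
    exact ⟨s, hs, hs'⟩
  obtain ⟨s, ⟨hs, hsc⟩, hmax⟩ := hS.exists_isGreatest hSn
  have hsc : Θ s = c := hsc
  have hsy : s < y' := lt_of_le_of_ne hs.2 (by rintro rfl; linarith)
  obtain ⟨t, h1, h2, h3⟩ := hfr' hsy (hcross s ⟨hs.1, by linarith [hs.2]⟩ hsc)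
  have h4 := (h3 ⟨by linarith [hs.1], by linarith⟩).1 h1
  obtain ⟨r, hr, hr'⟩ := intermediate_value_Icc' h2.le hΘ.continuousOn ⟨hy'.le, h4.le⟩
  have := hmax ⟨⟨by linarith [hr.1, hs.1], hr.2⟩, hr'⟩
  linarith [hr.1]

lemma exists_isPhaseAngle {p : ℝ} (hp : 1 < p) {u : ℝ → ℝ} (hu : ContDiff ℝ 1 u) (hu0 : u 0 = 0)
    {w : CI × CI} (hw : ReprE u w) (hne : ∀ x, phaseCurve hp w x ≠ 0) :
    ∃ θ, IsPhaseAngle u θ ∧ θ 1 = rotAngle (phaseCurve hp w) := by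
  obtain ⟨θ', hθ'⟩ := exists_isArgLift_Icc _ hne
  let Θ : ℝ → ℝ := fun x => θ' (projIcc 0 1 zero_le_one x)
  have hΘ : Continuous Θ := θ'.continuous.comp continuous_projIcc
  have hΘe : ∀ x (hx : x ∈ Icc (0:ℝ) 1), Θ x = θ' ⟨x, hx⟩ := fun x hx => by
    simp only [Θ, projIcc_of_mem _ hx]
  have hpos : ∀ z, 0 < ‖phaseCurve hp w z‖ := fun z => norm_pos_iff.2 (hne z)
  have hcos : ∀ x (hx : x ∈ Icc (0:ℝ) 1),
      phip p (deriv u x) = ‖phaseCurve hp w ⟨x, hx⟩‖ * Real.cos (Θ x) := fun x hx => by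
    rw [← hw.2 ⟨x, hx⟩, ← phaseCurve_re hp]; conv_lhs => rw [hθ' ⟨x, hx⟩]
    rw [Complex.re_ofReal_mul, Complex.exp_ofReal_mul_I_re, hΘe x hx]
  have hsin : ∀ x (hx : x ∈ Icc (0:ℝ) 1),
      u x = ‖phaseCurve hp w ⟨x, hx⟩‖ * Real.sin (Θ x) := fun x hx => by
    have : u x = (phaseCurve hp w ⟨x, hx⟩).im := by rw [phaseCurve_im, hw.1 ⟨x, hx⟩]
    rw [this]; conv_lhs => rw [hθ' ⟨x, hx⟩]
    rw [Complex.im_ofReal_mul, Complex.exp_ofReal_mul_I_im, hΘe x hx]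
  have hzero : ∀ x ∈ Icc (0:ℝ) 1, u x = 0 ↔ ∃ m : ℤ, Θ x = m * Real.pi := fun x hx => by
    rw [hsin x hx, mul_eq_zero, or_iff_right (hpos _).ne', Real.sin_eq_zero_iff]
    exact exists_congr fun m => eq_comm
  have m0 : (0:ℝ) ∈ Icc (0:ℝ) 1 := by simp
  have m1 : (1:ℝ) ∈ Icc (0:ℝ) 1 := by simp
  have hup : ∀ x ∈ Icc (0:ℝ) 1, ∀ y ∈ Icc (0:ℝ) 1, x < y → ∀ m : ℤ, m * Real.pi ≤ Θ x →
      m * Real.pi < Θ y := by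
    intro x hx y hy hxy m hm
    refine lt_of_crossing hΘ hxy (fun s hs hsm => ?_) hm
    have hs' : s ∈ Icc (0:ℝ) 1 := ⟨hx.1.trans hs.1, hs.2.trans hy.2⟩
    have hus : u s = 0 := (hzero s hs').2 ⟨m, hsm⟩
    set σ : ℝ := (-1) ^ m with hσ
    have hσ2 : σ * σ = 1 := by
      rw [hσ, ← mul_zpow]; simp
    have hds : 0 < σ * deriv u s := by
      have h1 := hcos s hs'
      rw [hsm, Real.cos_int_mul_pi, ← hσ] at h1
      have h2 : phip p (σ * deriv u s) = phip p σ * σ * ‖phaseCurve hp w ⟨s, hs'⟩‖ := by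
        rw [phip_mul, h1]; ring
      rw [← phip_pos_iff (p := p), h2, phip_mul_self hp]
      exact mul_pos (Real.rpow_pos_of_pos (abs_pos.2 (by rintro h; simp [h] at hσ2)) _) (hpos _)
    have hd : HasDerivAt (fun x => σ * u x) (σ * deriv u s) s :=
      ((hu.differentiable one_ne_zero) s).hasDerivAt.const_mul σ
    have hnear : ∀ᶠ t in 𝓝 s, |Θ t - m * Real.pi| < Real.pi := by
      have : Tendsto (fun t => |Θ t - m * Real.pi|) (𝓝 s) (𝓝 |Θ s - m * Real.pi|) :=
        ((hΘ.sub continuous_const).abs).tendsto s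
      rw [hsm, sub_self, abs_zero] at this
      exact this.eventually_lt_const Real.pi_pos
    filter_upwards [eventually_sign_of_hasDerivAt_pos hd hds (by simp [hus]), hnear]
      with t ht ht2 htm
    have ht' : t ∈ Icc (0:ℝ) 1 := ⟨hx.1.trans htm.1, htm.2.trans hy.2⟩
    have hst : σ * u t = ‖phaseCurve hp w ⟨t, ht'⟩‖ * Real.sin (Θ t - m * Real.pi) := by
      rw [Real.sin_sub_int_mul_pi, hsin t ht']; ring
    rw [abs_lt] at ht2
    constructor
    · intro h
      have h1 := ht.1 h
      rw [hst] at h1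
      have h2 := pos_of_mul_pos_right h1 (hpos _).le
      by_contra! hcon
      have := Real.sin_nonpos_of_nonpos_of_neg_pi_le (x := Θ t - m * Real.pi) (by linarith)
        (by linarith)
      linarith
    · intro h
      have h1 := ht.2 h
      rw [hst] at h1
      have h2 := neg_of_mul_neg_right h1 (hpos _).le
      by_contra! hcon
      have := Real.sin_nonneg_of_nonneg_of_le_pi (x := Θ t - m * Real.pi) (by linarith)
        (by linarith)
      linarith
  obtain ⟨j, hj⟩ := (hzero 0 m0).1 hu0
  refine ⟨fun x => Θ x - Θ 0, ⟨(hΘ.sub continuous_const).continuousOn, sub_self _, ?_, ?_⟩, ?_⟩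
  · intro x hx
    rw [hzero x hx]
    constructor
    · rintro ⟨m, hm⟩; exact ⟨m - j, by rw [hm, hj]; push_cast; ring⟩
    · rintro ⟨m, hm⟩; exact ⟨m + j, by push_cast; linarith⟩
  · intro x hx y hy hxy m hm
    have := hup x hx y hy hxy (m + j) (by push_cast; linarith)
    push_cast at this; linarith
  · rw [hθ'.rotAngle_eq hne]
    simp only [hΘe 0 m0, hΘe 1 m1]

namespace IsPhaseAngle

variable {u θ : ℝ → ℝ}

lemma injective_zero (h : IsPhaseAngle u θ) {x y : ℝ} (hx : x ∈ Icc (0:ℝ) 1)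
    (hy : y ∈ Icc (0:ℝ) 1) {m : ℤ} (hxm : θ x = m * Real.pi) (hym : θ y = m * Real.pi) : x = y := by
  rcases lt_trichotomy x y with hlt | rfl | hlt
  · have := h.up x hx y hy hlt m hxm.ge; linarith
  · rfl
  · have := h.up y hy x hx hlt m hym.ge; linarith

lemma pos_one (h : IsPhaseAngle u θ) : 0 < θ 1 := by
  simpa using h.up 0 (by simp) 1 (by simp) zero_lt_one 0 (by simp [h.zero])

lemma ncard_zeros (h : IsPhaseAngle u θ) {k : ℕ} (hk : 1 ≤ k) (h1 : θ 1 = k * Real.pi) :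
    {x ∈ Ioo (0:ℝ) 1 | u x = 0}.Finite ∧ {x ∈ Ioo (0:ℝ) 1 | u x = 0}.ncard = k - 1 ∧ u 1 = 0 := by
  have hpi := Real.pi_pos
  have hex : ∀ m : ℕ, ∃ x ∈ Icc (0:ℝ) 1, m ≤ k → θ x = m * Real.pi := fun m => by
    by_cases hm : m ≤ k
    · have hm' : (m:ℝ) ≤ k := by exact_mod_cast hm
      obtain ⟨x, hx, hx'⟩ := intermediate_value_Icc zero_le_one h.cont
        (show (m:ℝ) * Real.pi ∈ Icc _ _ by rw [h.zero, h1]; exact ⟨by positivity, by gcongr⟩)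
      exact ⟨x, hx, fun _ => hx'⟩
    · exact ⟨0, by simp, fun h => absurd h hm⟩
  choose xs hxs hθ using hex
  have hset : {x ∈ Ioo (0:ℝ) 1 | u x = 0} = ((Finset.Ioo 0 k).image xs : Finset ℝ) := by
    ext x
    simp only [mem_ofPred_eq, Finset.coe_image, mem_image, Finset.coe_Ioo]
    constructor
    · rintro ⟨hx, hux⟩
      have hx' : x ∈ Icc (0:ℝ) 1 := Ioo_subset_Icc_self hx
      obtain ⟨m, hm⟩ := (h.zeros x hx').1 hux
      have hm0 : 0 < m := by
        have := h.up 0 (by simp) x hx' hx.1 0 (by simp [h.zero])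
        rw [hm] at this
        have h0m : (0:ℝ) < (m:ℝ) * Real.pi := by simpa using this
        have h2 : (0:ℝ) < (m:ℝ) := pos_of_mul_pos_left h0m hpi.le
        exact_mod_cast h2
      have hmk : m < k := by
        have := h.up x hx' 1 (by simp) hx.2 m hm.ge
        rw [h1] at this
        have := lt_of_mul_lt_mul_right this hpi.le
        exact_mod_cast this
      lift m to ℕ using hm0.le
      refine ⟨m, ⟨by exact_mod_cast hm0, by exact_mod_cast hmk⟩, ?_⟩
      exact h.injective_zero (hxs m) hx' (m := m) (by simpa using hθ m (by exact_mod_cast hmk.le)) hm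
    · rintro ⟨m, hm, rfl⟩
      have hθm := hθ m hm.2.le
      refine ⟨⟨lt_of_le_of_ne (hxs m).1 ?_, lt_of_le_of_ne (hxs m).2 ?_⟩,
        (h.zeros _ (hxs m)).2 ⟨m, by simpa using hθm⟩⟩
      · intro h0
        rw [← h0, h.zero] at hθm
        have : (0:ℝ) < m * Real.pi := mul_pos (by exact_mod_cast hm.1) hpi
        linarith
      · intro h0
        rw [h0, h1] at hθm
        have := mul_right_cancel₀ hpi.ne' hθm
        have h2 := hm.2
        have : k = m := by exact_mod_cast this
        omega
  have hinj : Set.InjOn xs (Finset.Ioo 0 k : Finset ℕ) := by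
    intro m hm n hn hmn
    simp only [Finset.coe_Ioo] at hm hn
    have e1 := hθ m hm.2.le
    rw [hmn, hθ n hn.2.le] at e1
    have := mul_right_cancel₀ hpi.ne' e1
    exact_mod_cast this.symm
  refine ⟨by rw [hset]; exact Finset.finite_toSet _, ?_, ?_⟩
  · rw [hset, Set.ncard_coe_finset, Finset.card_image_of_injOn hinj, Nat.card_Ioo]; omega
  · exact (h.zeros 1 (by simp)).2 ⟨k, by simpa using h1⟩

lemma one_eq_of_ncard (h : IsPhaseAngle u θ) {k : ℕ} (hk : 1 ≤ k) (h1 : u 1 = 0)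
    (hc : {x ∈ Ioo (0:ℝ) 1 | u x = 0}.ncard = k - 1) : θ 1 = k * Real.pi := by
  obtain ⟨m, hm⟩ := (h.zeros 1 (by simp)).1 h1
  have hm0 : 0 < m := by
    have := h.pos_one
    rw [hm] at this
    have : (0:ℝ) < m := pos_of_mul_pos_left this Real.pi_pos.le
    exact_mod_cast this
  lift m to ℕ using hm0.le
  have hm1 : 1 ≤ m := by exact_mod_cast hm0
  have := (h.ncard_zeros hm1 (by simpa using hm)).2.1
  obtain rfl : m = k := by omega
  simpa using hm

end IsPhaseAngle

lemma ReprE.phaseCurve_ne_zero {p : ℝ} (hp : 1 < p) {u : ℝ → ℝ} {w : CI × CI} (hw : ReprE u w)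
    (h : ∀ x ∈ Icc (0:ℝ) 1, u x = 0 → deriv u x ≠ 0) : ∀ x, phaseCurve hp w x ≠ 0 := fun x => by
  rw [phaseCurve_ne_zero_iff, hw.1, hw.2]; exact h x x.2

lemma MemS.rotAngle_eq {p : ℝ} (hp : 1 < p) {k : ℕ} (hk : 1 ≤ k) {ν : ℝ} {u : ℝ → ℝ}
    (hu : MemS k ν u) {w : CI × CI} (hw : ReprE u w) :
    rotAngle (phaseCurve hp w) = k * Real.pi := by
  obtain ⟨⟨hC, h0, h1⟩, hfin, hcard, hsimple, -⟩ := hu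
  obtain ⟨θ, hθ, hθ1⟩ := exists_isPhaseAngle hp hC h0 hw (hw.phaseCurve_ne_zero hp hsimple)
  rw [← hθ1]
  exact hθ.one_eq_of_ncard hk h1 hcard

lemma MemS.deriv_pos {k : ℕ} {ν : ℝ} (hν : ν = 1 ∨ ν = -1) {u : ℝ → ℝ}
    (hu : MemS k ν u) : 0 < ν * deriv u 0 := by
  obtain ⟨⟨hC, h0, h1⟩, hfin, hcard, hsimple, δ, hδ, hpos⟩ := hu
  have hd : HasDerivAt u (deriv u 0) 0 := ((hC.differentiable one_ne_zero) 0).hasDerivAt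
  have hne : ν * deriv u 0 ≠ 0 :=
    mul_ne_zero (by rcases hν with rfl | rfl <;> norm_num) (hsimple 0 (by simp) h0)
  by_contra! hcon
  have hneg := lt_of_le_of_ne hcon hne
  have hd' : HasDerivAt (fun x => -(ν * u x)) (-(ν * deriv u 0)) 0 := (hd.const_mul ν).neg
  have hev := eventually_sign_of_hasDerivAt_pos hd' (by linarith) (by simp [h0])
  have hev2 := (hev.filter_mono (nhdsWithin_le_nhds (s := Ioi 0))).and (Ioo_mem_nhdsGT hδ)
  obtain ⟨t, ht, ht'⟩ := hev2.exists
  have h3 := ht.1 ht'.1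
  have h4 := hpos t ht'
  linarith

lemma memS_of_rotAngle_eq {p : ℝ} (hp : 1 < p) {k : ℕ} (hk : 1 ≤ k) {ν : ℝ} {u : ℝ → ℝ}
    (hC : ContDiff ℝ 1 u) (h0 : u 0 = 0) (hd0 : 0 < ν * deriv u 0)
    {w : CI × CI} (hw : ReprE u w) (hne : ∀ x, phaseCurve hp w x ≠ 0)
    (hrot : rotAngle (phaseCurve hp w) = k * Real.pi) : MemS k ν u := by
  obtain ⟨θ, hθ, hθ1⟩ := exists_isPhaseAngle hp hC h0 hw hne
  obtain ⟨hfin, hcard, h1⟩ := hθ.ncard_zeros hk (hθ1.trans hrot)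
  refine ⟨⟨hC, h0, h1⟩, hfin, hcard, fun x hx hux => ?_, ?_⟩
  · have := (phaseCurve_ne_zero_iff hp w ⟨x, hx⟩).1 (hne _)
    rw [hw.1, hw.2] at this
    exact this hux
  · have hd : HasDerivAt u (deriv u 0) 0 := ((hC.differentiable one_ne_zero) 0).hasDerivAt
    have hev := eventually_sign_of_hasDerivAt_pos (hd.const_mul ν) hd0 (by simp [h0])
    obtain ⟨δ, hδ, hb⟩ := Metric.eventually_nhds_iff.1 hev
    refine ⟨δ, hδ, fun x hx => (hb ?_).1 hx.1⟩
    rw [Real.dist_eq, sub_zero, abs_of_pos hx.1]; exact hx.2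

end PhaseAngle

section Sturm

variable {p : ℝ}

lemma mul_phip_le (hp : 1 < p) (s t : ℝ) :
    p * (s * phip p t) ≤ |s| ^ p + (p - 1) * |t| ^ p := by
  have hpq := Real.HolderConjugate.conjExponent hp
  have h := Real.young_inequality s (phip p t) hpq
  have hp1 : 0 < p - 1 := by linarith
  have h2 : |phip p t| ^ p.conjExponent = |t| ^ p := by
    rw [abs_phip hp, ← Real.rpow_mul (abs_nonneg _), Real.conjExponent]
    congr 1
    field_simp
  rw [h2, Real.conjExponent] at h
  have hp0 : 0 < p := by linarith
  calc p * (s * phip p t) ≤ p * (|s| ^ p / p + |t| ^ p / (p / (p - 1))) := by gcongr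
    _ = _ := by field_simp

lemma exists_tendsto_div {u v : ℝ → ℝ} {u' v' z : ℝ} (hu : HasDerivAt u u' z)
    (hv : HasDerivAt v v' z) (hu0 : u z = 0) (hs : v z = 0 → v' ≠ 0) :
    ∃ l, Tendsto (fun x => u x / v x) (𝓝[≠] z) (𝓝 l) := by
  by_cases h : v z = 0
  · refine ⟨u' / v', ?_⟩
    have := (hasDerivAt_iff_tendsto_slope.1 hu).div (hasDerivAt_iff_tendsto_slope.1 hv) (hs h)
    refine this.congr' ?_
    filter_upwards [self_mem_nhdsWithin] with x hx
    have hx' : x - z ≠ 0 := sub_ne_zero.2 hx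
    simp only [Pi.div_apply, slope_def_field, hu0, h, sub_zero]
    by_cases hvx : v x = 0
    · simp [hvx]
    · field_simp
  · exact ⟨u z / v z, ((hu.continuousAt.div hv.continuousAt h).tendsto).mono_left
      nhdsWithin_le_nhds⟩

/-- Picone's identity for half-linear equations, with the nonnegative remainder given by
Young's inequality, forbids a strictly larger coefficient on a nodal interval. -/
lemma not_nonvanishing_of_lt (hp : 1 < p) {u v cu cv : ℝ → ℝ} {z₀ z₁ : ℝ} (hz : z₀ < z₁)
    (hu : ContDiff ℝ 1 u) (hv : ContDiff ℝ 1 v)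
    (hwu : ∀ x ∈ Ioo z₀ z₁, HasDerivAt (fun y => phip p (deriv u y)) (-(cu x * phip p (u x))) x)
    (hwv : ∀ x ∈ Ioo z₀ z₁, HasDerivAt (fun y => phip p (deriv v y)) (-(cv x * phip p (v x))) x)
    (hu0 : u z₀ = 0) (hu1 : u z₁ = 0)
    (hs0 : v z₀ = 0 → deriv v z₀ ≠ 0) (hs1 : v z₁ = 0 → deriv v z₁ ≠ 0)
    (hune : ∀ x ∈ Ioo z₀ z₁, u x ≠ 0) (hvne : ∀ x ∈ Ioo z₀ z₁, v x ≠ 0)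
    (hc : ∀ x ∈ Ioo z₀ z₁, cu x < cv x) : False := by
  have hdu : ∀ x, HasDerivAt u (deriv u x) x := fun x =>
    ((hu.differentiable one_ne_zero) x).hasDerivAt
  have hdv : ∀ x, HasDerivAt v (deriv v x) x := fun x =>
    ((hv.differentiable one_ne_zero) x).hasDerivAt
  let Q : ℝ → ℝ := fun x =>
    u x * phip p (deriv u x) - |u x| ^ p * phip p (deriv v x) / phip p (v x)
  have hQ : ∀ x ∈ Ioo z₀ z₁, Q x = u x * (phip p (deriv u x) - phip p (u x / v x * deriv v x)) := by
    intro x hx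
    have hv0 := phip_ne_zero (p := p) (hvne x hx)
    simp only [Q]
    rw [phip_mul, phip_div _ _ _ (hvne x hx), ← phip_mul_self hp]
    field_simp
  have hQd : ∀ x ∈ Ioo z₀ z₁, ∃ Q', 0 < Q' ∧ HasDerivAt Q Q' x := by
    intro x hx
    have hvx := hvne x hx
    have hux := hune x hx
    have hv0 := phip_ne_zero (p := p) hvx
    have h1 := (hdu x).mul (hwu x hx)
    have h2 := ((hasDerivAt_abs_rpow_phip hp (u x)).comp x (hdu x)).mul (hwv x hx)
    have h3 := h2.div ((hasDerivAt_phip (p := p) hvx).comp x (hdv x)) hv0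
    refine ⟨_, ?_, h1.sub h3⟩
    simp only [Function.comp_apply, Pi.mul_apply]
    have hy := mul_phip_le hp (deriv u x) (u x / v x * deriv v x)
    have hpos : 0 < |u x| ^ p := Real.rpow_pos_of_pos (abs_pos.2 hux) _
    have hcc := mul_pos (sub_pos.2 (hc x hx)) hpos
    have hvv : |v x| ^ (p - 2) = phip p (v x) / v x := by
      rw [phip]; field_simp
    rw [hvv]
    rw [← phip_mul_self hp (deriv u x), ← phip_mul_self hp (u x / v x * deriv v x), phip_mul,
      phip_div _ _ _ hvx] at hy
    rw [← phip_mul_self hp] at hcc ⊢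
    generalize phip p (v x) = V at *
    generalize phip p (u x) = U at *
    generalize phip p (deriv u x) = DU at *
    generalize phip p (deriv v x) = DV at *
    generalize deriv u x = du at *
    generalize deriv v x = dv at *
    have e : du * DU + u x * -(cu x * U) -
        ((p * U * du * DV + U * u x * -(cv x * V)) * V - U * u x * DV * ((p - 1) * (V / v x) * dv)) /
          V ^ 2 = (DU * du + (p - 1) * (U / V * DV * (u x / v x * dv)) - p * (du * (U / V * DV)))
            + (cv x - cu x) * (U * u x) := by
      field_simp
      ring
    rw [e]
    linarith
  have hmono : StrictMonoOn Q (Ioo z₀ z₁) := by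
    refine strictMonoOn_of_deriv_pos (convex_Ioo _ _) (fun x hx => ?_) (fun x hx => ?_)
    · obtain ⟨Q', -, h⟩ := hQd x hx
      exact h.continuousAt.continuousWithinAt
    · rw [interior_Ioo] at hx
      obtain ⟨Q', h', h⟩ := hQd x hx
      rwa [h.deriv]
  have hlim : ∀ z, u z = 0 → (v z = 0 → deriv v z ≠ 0) → z ∉ Ioo z₀ z₁ →
      Tendsto Q (𝓝[Ioo z₀ z₁] z) (𝓝 0) := by
    intro z huz hsz hzn
    obtain ⟨l, hl⟩ := exists_tendsto_div (hdu z) (hdv z) huz hsz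
    have hle : 𝓝[Ioo z₀ z₁] z ≤ 𝓝[≠] z := nhdsWithin_mono _ (fun x hx => by
      rintro rfl; exact hzn hx)
    have cu' : Tendsto (deriv u) (𝓝[Ioo z₀ z₁] z) (𝓝 (deriv u z)) :=
      ((hu.continuous_deriv le_rfl).tendsto z).mono_left nhdsWithin_le_nhds
    have cv' : Tendsto (deriv v) (𝓝[Ioo z₀ z₁] z) (𝓝 (deriv v z)) :=
      ((hv.continuous_deriv le_rfl).tendsto z).mono_left nhdsWithin_le_nhds
    have cu0 : Tendsto u (𝓝[Ioo z₀ z₁] z) (𝓝 0) := by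
      have := (hu.continuous.tendsto z).mono_left (nhdsWithin_le_nhds (s := Ioo z₀ z₁))
      rwa [huz] at this
    have hφ := continuous_phip hp
    have := cu0.mul (((hφ.tendsto _).comp cu').sub ((hφ.tendsto _).comp ((hl.mono_left hle).mul cv')))
    rw [zero_mul] at this
    refine this.congr' ?_
    filter_upwards [self_mem_nhdsWithin] with x hx
    exact (hQ x hx).symm
  have l0 := hlim z₀ hu0 hs0 (by simp)
  have l1 := hlim z₁ hu1 hs1 (by simp)
  rw [nhdsWithin_Ioo_eq_nhdsGT hz] at l0
  rw [nhdsWithin_Ioo_eq_nhdsLT hz] at l1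
  obtain ⟨x, hx0, hx1⟩ := exists_between hz
  obtain ⟨y, hy0, hy1⟩ := exists_between hx1
  have h0 : 0 ≤ Q x := by
    refine le_of_tendsto l0 ?_
    filter_upwards [Ioo_mem_nhdsGT hx0] with t ht
    exact (hmono ⟨ht.1, ht.2.trans hx1⟩ ⟨hx0, hx1⟩ ht.2).le
  have h1 : Q y ≤ 0 := by
    refine ge_of_tendsto l1 ?_
    filter_upwards [Ioo_mem_nhdsLT hy1] with t ht
    exact (hmono ⟨hx0.trans hy0, hy1⟩ ⟨(hx0.trans hy0).trans ht.1, ht.2⟩ ht.1).le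
  have := hmono ⟨hx0, hx1⟩ ⟨hx0.trans hy0, hy1⟩ hy0
  linarith

lemma IsPhaseAngle.ne_zero_of_between {u θ : ℝ → ℝ} (h : IsPhaseAngle u θ) {m : ℕ} {x₀ x₁ : ℝ}
    (hx₀ : x₀ ∈ Icc (0:ℝ) 1) (hx₁ : x₁ ∈ Icc (0:ℝ) 1) (h0 : m * Real.pi ≤ θ x₀)
    (h1 : θ x₁ ≤ (m + 1 : ℕ) * Real.pi) {x : ℝ} (hx : x ∈ Ioo x₀ x₁) : u x ≠ 0 := by
  intro hux
  have hxI : x ∈ Icc (0:ℝ) 1 := ⟨hx₀.1.trans hx.1.le, hx.2.le.trans hx₁.2⟩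
  obtain ⟨j, hj⟩ := (h.zeros x hxI).1 hux
  have a1 := h.up x₀ hx₀ x hxI hx.1 m (by simpa using h0)
  have a2 := h.up x hxI x₁ hx₁ hx.2 j hj.ge
  rw [hj] at a1
  have b1 := lt_of_mul_lt_mul_right a1 Real.pi_pos.le
  have b2 := lt_of_mul_lt_mul_right (a2.trans_le h1) Real.pi_pos.le
  have c1 : (m:ℤ) < j := by exact_mod_cast b1
  have c2 : j < ((m + 1 : ℕ) : ℤ) := by exact_mod_cast b2
  push_cast at c2
  omega

lemma IsPhaseAngle.lt_of_le {u v cu cv θu θv : ℝ → ℝ} (hp : 1 < p)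
    (hu : ContDiff ℝ 1 u) (hv : ContDiff ℝ 1 v)
    (hwu : ∀ x ∈ Ioo (0:ℝ) 1, HasDerivAt (fun y => phip p (deriv u y)) (-(cu x * phip p (u x))) x)
    (hwv : ∀ x ∈ Ioo (0:ℝ) 1, HasDerivAt (fun y => phip p (deriv v y)) (-(cv x * phip p (v x))) x)
    (hs : ∀ x ∈ Icc (0:ℝ) 1, v x = 0 → deriv v x ≠ 0)
    (hc : ∀ x ∈ Ioo (0:ℝ) 1, u x ≠ 0 → v x ≠ 0 → cu x < cv x)
    (hθu : IsPhaseAngle u θu) (hθv : IsPhaseAngle v θv) (m : ℕ) :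
    ∀ x ∈ Icc (0:ℝ) 1, θu x = (m + 1 : ℕ) * Real.pi → (m + 1 : ℕ) * Real.pi < θv x := by
  have key : ∀ (m : ℕ), ∀ x₀ ∈ Icc (0:ℝ) 1, ∀ x₁ ∈ Icc (0:ℝ) 1, x₀ < x₁ →
      θu x₀ = m * Real.pi → m * Real.pi ≤ θv x₀ → θu x₁ = (m + 1 : ℕ) * Real.pi →
      (m + 1 : ℕ) * Real.pi < θv x₁ := by
    intro m x₀ h₀ x₁ h₁ hlt e0 e0' e1
    by_contra! hcon
    have hsub : Ioo x₀ x₁ ⊆ Ioo 0 1 := Ioo_subset_Ioo h₀.1 h₁.2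
    have hune : ∀ x ∈ Ioo x₀ x₁, u x ≠ 0 := fun x hx =>
      hθu.ne_zero_of_between h₀ h₁ e0.ge e1.le hx
    have hvne : ∀ x ∈ Ioo x₀ x₁, v x ≠ 0 := fun x hx =>
      hθv.ne_zero_of_between h₀ h₁ e0' hcon hx
    exact not_nonvanishing_of_lt hp hlt hu hv (fun x hx => hwu x (hsub hx))
      (fun x hx => hwv x (hsub hx)) ((hθu.zeros _ h₀).2 ⟨m, by simpa using e0⟩)
      ((hθu.zeros _ h₁).2 ⟨(m + 1 : ℕ), by simpa using e1⟩) (hs _ h₀) (hs _ h₁) hune hvne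
      (fun x hx => hc x (hsub hx) (hune x hx) (hvne x hx))
  have zlt : ∀ (m : ℕ), ∀ x ∈ Icc (0:ℝ) 1, θu x = (m + 1 : ℕ) * Real.pi → 0 < x := by
    intro m x hx e
    refine lt_of_le_of_ne hx.1 ?_
    rintro rfl
    rw [hθu.zero] at e
    have : (0:ℝ) < (m + 1 : ℕ) * Real.pi := by positivity
    linarith
  induction m with
  | zero =>
    intro x hx e
    exact key 0 0 (by simp) x hx (zlt 0 x hx e) (by simp [hθu.zero]) (by simp [hθv.zero]) e
  | succ m ih =>
    intro x hx e
    have hlt := zlt _ x hx e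
    have hsub : Icc 0 x ⊆ Icc (0:ℝ) 1 := Icc_subset_Icc_right hx.2
    obtain ⟨x₀, hx₀, e₀⟩ := intermediate_value_Icc hlt.le (hθu.cont.mono hsub)
      (show ((m + 1 : ℕ):ℝ) * Real.pi ∈ Icc _ _ by
        rw [hθu.zero, e]; refine ⟨by positivity, ?_⟩; gcongr; omega)
    refine key (m + 1) x₀ (hsub hx₀) x hx ?_ e₀ (ih x₀ (hsub hx₀) e₀).le e
    refine lt_of_le_of_ne hx₀.2 ?_
    rintro rfl
    rw [e₀] at e
    have := mul_right_cancel₀ Real.pi_pos.ne' e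
    norm_cast at this
    omega

/-- Sturm comparison in terms of the total rotation of the phase curves. -/
lemma rotAngle_lt_of_le (hp : 1 < p) {u v cu cv : ℝ → ℝ} {w w' : CI × CI}
    (hu : ContDiff ℝ 1 u) (hv : ContDiff ℝ 1 v) (hu0 : u 0 = 0) (hv0 : v 0 = 0)
    (hw : ReprE u w) (hw' : ReprE v w') (hne : ∀ x, phaseCurve hp w x ≠ 0)
    (hne' : ∀ x, phaseCurve hp w' x ≠ 0)
    (hwu : ∀ x ∈ Ioo (0:ℝ) 1, HasDerivAt (fun y => phip p (deriv u y)) (-(cu x * phip p (u x))) x)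
    (hwv : ∀ x ∈ Ioo (0:ℝ) 1, HasDerivAt (fun y => phip p (deriv v y)) (-(cv x * phip p (v x))) x)
    (hc : ∀ x ∈ Ioo (0:ℝ) 1, u x ≠ 0 → v x ≠ 0 → cu x < cv x) {k : ℕ} (hk : 1 ≤ k)
    (h : k * Real.pi ≤ rotAngle (phaseCurve hp w)) :
    k * Real.pi < rotAngle (phaseCurve hp w') := by
  obtain ⟨θu, hθu, e⟩ := exists_isPhaseAngle hp hu hu0 hw hne
  obtain ⟨θv, hθv, e'⟩ := exists_isPhaseAngle hp hv hv0 hw' hne'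
  rw [← e] at h
  rw [← e']
  obtain ⟨m, rfl⟩ : ∃ m, k = m + 1 := ⟨k - 1, by omega⟩
  obtain ⟨x, hx, ex⟩ := intermediate_value_Icc zero_le_one hθu.cont
    (show ((m + 1 : ℕ):ℝ) * Real.pi ∈ Icc _ _ by rw [hθu.zero]; exact ⟨by positivity, h⟩)
  have hs : ∀ x ∈ Icc (0:ℝ) 1, v x = 0 → deriv v x ≠ 0 := fun x hx => by
    have := (phaseCurve_ne_zero_iff hp w' ⟨x, hx⟩).1 (hne' _)
    rwa [hw'.1, hw'.2] at this
  have h1 := IsPhaseAngle.lt_of_le hp hu hv hwu hwv hs hc hθu hθv m x hx ex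
  rcases hx.2.eq_or_lt with rfl | hlt
  · exact h1
  · simpa using hθv.up x hx 1 (by simp) hlt (m + 1 : ℕ) (by simpa using h1.le)

end Sturm

section Shooting

variable {p : ℝ}

/-- the projection of the line onto `[0,1]`. -/
noncomputable abbrev pI : ℝ → Icc (0:ℝ) 1 := projIcc 0 1 zero_le_one

/-- triples `(λ, U, V)` with `U' = V`, `U 0 = 0` and `(φ_p(V))'(x) = -G(x, U(x - h), λ)`,
in integrated form. -/
def delaySol (p : ℝ) (G : ℝ → ℝ → ℝ → ℝ) (h : ℝ) : Set Xsp :=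
  {z | (∀ x : Icc (0:ℝ) 1, z.2.1 x = ∫ t in (0:ℝ)..x, z.2.2 (pI t)) ∧
    ∀ x : Icc (0:ℝ) 1, phip p (z.2.2 x) =
      phip p (z.2.2 0) - ∫ t in (0:ℝ)..x, G t (z.2.1 (pI (t - h))) z.1}

lemma isClosed_delaySol (hp : 1 < p) {G : ℝ → ℝ → ℝ → ℝ}
    (hG : Continuous fun q : ℝ × ℝ × ℝ => G q.1 q.2.1 q.2.2) :
    IsClosed {y : ℝ × Xsp | y.2 ∈ delaySol p G y.1} := by
  have hφ := continuous_phip hp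
  have hpi : Continuous pI := continuous_projIcc
  have h1 : ∀ x : Icc (0:ℝ) 1, IsClosed {y : ℝ × Xsp |
      y.2.2.1 x = ∫ t in (0:ℝ)..x, y.2.2.2 (pI t)} := fun x => by
    refine isClosed_eq (by fun_prop) ?_
    refine intervalIntegral.continuous_parametric_intervalIntegral_of_continuous'
      (f := fun (y : ℝ × Xsp) t => y.2.2.2 (pI t)) ?_ _ _
    simp only [Function.uncurry_def]
    fun_prop
  have h2 : ∀ x : Icc (0:ℝ) 1, IsClosed {y : ℝ × Xsp | phip p (y.2.2.2 x) =
      phip p (y.2.2.2 0) - ∫ t in (0:ℝ)..x, G t (y.2.2.1 (pI (t - y.1))) y.2.1} := fun x => by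
    refine isClosed_eq (by fun_prop) (Continuous.sub (by fun_prop) ?_)
    refine intervalIntegral.continuous_parametric_intervalIntegral_of_continuous'
      (f := fun (y : ℝ × Xsp) t => G t (y.2.2.1 (pI (t - y.1))) y.2.1) ?_ _ _
    have : Continuous fun r : (ℝ × Xsp) × ℝ => (r.2, r.1.2.2.1 (pI (r.2 - r.1.1)), r.1.2.1) := by
      fun_prop
    exact hG.comp this
  have := (isClosed_iInter h1).inter (isClosed_iInter h2)
  convert this using 1
  ext y
  simp [delaySol]

/-- functions on `[0,1]` with a common bound and Lipschitz constant. -/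
def lipBall (B : ℝ) : Set CI := {f | (∀ x, |f x| ≤ B) ∧ ∀ x y, |f x - f y| ≤ B * |(x:ℝ) - y|}

lemma isCompact_lipBall (B : ℝ) : IsCompact (lipBall B) := by
  refine ArzelaAscoli.isCompact_of_equicontinuous _ ?_ ?_
  · have hK : IsCompact (Set.pi univ fun _ : Icc (0:ℝ) 1 => Icc (-B) B) :=
      isCompact_univ_pi fun _ => isCompact_Icc
    have hcl : IsClosed {f : Icc (0:ℝ) 1 → ℝ | ∀ x y, |f x - f y| ≤ B * |(x:ℝ) - y|} := by
      simp only [ofPred_forall]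
      refine isClosed_iInter fun x => isClosed_iInter fun y => isClosed_le ?_ continuous_const
      fun_prop
    convert hK.inter_right hcl using 1
    ext f
    constructor
    · rintro ⟨g, hg, rfl⟩
      exact ⟨fun x _ => abs_le.1 (hg.1 x), hg.2⟩
    · rintro ⟨hf1, hf2⟩
      have hL : LipschitzWith (Real.toNNReal B) f := by
        refine LipschitzWith.of_dist_le_mul fun x y => ?_
        rw [Real.dist_eq, Subtype.dist_eq, Real.dist_eq]
        exact (hf2 x y).trans (by gcongr; exact Real.le_coe_toNNReal B)
      exact ⟨⟨f, hL.continuous⟩, ⟨fun x => abs_le.2 (hf1 x trivial), hf2⟩, rfl⟩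
  · refine UniformEquicontinuous.equicontinuous ?_
    refine LipschitzWith.uniformEquicontinuous _ (Real.toNNReal B) fun f => ?_
    refine LipschitzWith.of_dist_le_mul fun x y => ?_
    rw [Real.dist_eq, Subtype.dist_eq, Real.dist_eq]
    exact (f.2.2 x y).trans (by gcongr; exact Real.le_coe_toNNReal B)

lemma abs_integral_sub_le {g : ℝ → ℝ} (hg : Continuous g) {B : ℝ} (hB : ∀ t, |g t| ≤ B) (c : ℝ)
    (x y : ℝ) : |(c + ∫ t in (0:ℝ)..x, g t) - (c + ∫ t in (0:ℝ)..y, g t)| ≤ B * |x - y| := by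
  rw [add_sub_add_left_eq_sub, intervalIntegral.integral_interval_sub_left
    (hg.intervalIntegrable _ _) (hg.intervalIntegrable _ _)]
  exact intervalIntegral.norm_integral_le_of_norm_le_const fun t _ => (Real.norm_eq_abs _).trans_le (hB t)

lemma exists_isCompact_delaySol (hp : 1 < p) {G : ℝ → ℝ → ℝ → ℝ}
    (hG : Continuous fun q : ℝ × ℝ × ℝ => G q.1 q.2.1 q.2.2) {K : ℝ}
    (hK : ∀ x s l, |G x s l| ≤ K) (L : ℝ) :
    ∃ S : Set Xsp, IsCompact S ∧ ∀ h, ∀ z ∈ delaySol p G h, |z.1| ≤ L → |z.2.2 0| ≤ L → z ∈ S := by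
  have hpi : Continuous pI := continuous_projIcc
  have hφ' := continuous_phip (one_lt_conj hp)
  have hp1 : 0 ≤ p - 1 := by linarith
  have hq1 : 0 ≤ p / (p - 1) - 1 := by have := one_lt_conj hp; linarith
  let B₁ := |L| ^ (p - 1) + K
  let B₂ := B₁ ^ (p / (p - 1) - 1)
  let B := max (max B₁ K) B₂
  have hK0 : 0 ≤ K := (abs_nonneg _).trans (hK 0 0 0)
  let Φ : ℝ × CI × CI → Xsp := fun z =>
    (z.1, z.2.1, ContinuousMap.comp ⟨phip (p / (p - 1)), hφ'⟩ z.2.2)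
  have hΦ : Continuous Φ := continuous_fst.prodMk ((continuous_fst.comp continuous_snd).prodMk
    ((ContinuousMap.continuous_postcomp _).comp (continuous_snd.comp continuous_snd)))
  refine ⟨Φ '' (Icc (-L) L ×ˢ lipBall B ×ˢ lipBall B),
    (isCompact_Icc.prod ((isCompact_lipBall B).prod (isCompact_lipBall B))).image hΦ, ?_⟩
  rintro h ⟨l, U, V⟩ ⟨h1, h2⟩ hl hV
  simp only at h1 h2 hl hV
  let W : CI := ContinuousMap.comp ⟨phip p, continuous_phip hp⟩ V
  have hg : Continuous fun t => -G t (U (pI (t - h))) l := by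
    have : Continuous fun t => (t, U (pI (t - h)), l) := by fun_prop
    exact (hG.comp this).neg
  have hgK : ∀ t, |-G t (U (pI (t - h))) l| ≤ K := fun t => by rw [abs_neg]; exact hK _ _ _
  have hW : ∀ x, W x = phip p (V 0) + ∫ t in (0:ℝ)..x, -G t (U (pI (t - h))) l := fun x => by
    rw [intervalIntegral.integral_neg, ← sub_eq_add_neg]; exact h2 x
  have hx1 : ∀ x : Icc (0:ℝ) 1, |(x:ℝ) - 0| ≤ 1 := fun x => by
    rw [sub_zero, abs_of_nonneg x.2.1]; exact x.2.2
  have hWB : ∀ x, |W x| ≤ B₁ := fun x => by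
    have hb := abs_integral_sub_le hg hgK (phip p (V 0)) x 0
    rw [← hW, intervalIntegral.integral_same, add_zero] at hb
    have hb2 : K * |(x:ℝ) - 0| ≤ K := mul_le_of_le_one_right hK0 (hx1 x)
    have hb3 : |phip p (V 0)| ≤ |L| ^ (p - 1) := by
      rw [abs_phip hp]
      exact Real.rpow_le_rpow (abs_nonneg _) (hV.trans (le_abs_self L)) hp1
    have := abs_sub_abs_le_abs_sub (W x) (phip p (V 0))
    simp only [B₁]
    linarith
  have hVB : ∀ x, |V x| ≤ B₂ := fun x => by
    rw [← phip_phip_conj hp (V x), abs_phip (one_lt_conj hp)]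
    exact Real.rpow_le_rpow (abs_nonneg _) (hWB x) hq1
  have hVc : Continuous fun t => V (pI t) := by fun_prop
  have hB1 : B₁ ≤ B := (le_max_left _ _).trans (le_max_left _ _)
  have hB2 : B₂ ≤ B := le_max_right _ _
  have hBK : K ≤ B := (le_max_right _ _).trans (le_max_left _ _)
  have hB0 : 0 ≤ B₂ := (abs_nonneg _).trans (hVB 0)
  have hU : ∀ x y : Icc (0:ℝ) 1, |U x - U y| ≤ B₂ * |(x:ℝ) - y| := fun x y => by
    have := abs_integral_sub_le hVc (fun t => hVB (pI t)) 0 x y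
    rwa [zero_add, zero_add, ← h1, ← h1] at this
  refine ⟨(l, U, W), ⟨abs_le.1 hl, ⟨fun x => ?_, fun x y => ?_⟩, fun x => (hWB x).trans hB1,
    fun x y => ?_⟩, ?_⟩
  · have := hU x 0
    have h0 : U 0 = 0 := by rw [h1]; simp
    rw [h0, sub_zero] at this
    refine this.trans (le_trans (mul_le_of_le_one_right hB0 (hx1 x)) hB2)
  · exact (hU x y).trans (by gcongr)
  · rw [hW, hW]
    exact (abs_integral_sub_le hg hgK _ _ _).trans (by gcongr)
  · simp only [Φ, W, Prod.mk.injEq, true_and]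
    ext x
    simp [phip_phip_conj hp]

/-- Solutions of the delayed problem with small delay lie in any open set which contains the
solutions of the problem without delay. -/
lemma exists_forall_delaySol_mem (hp : 1 < p) {G : ℝ → ℝ → ℝ → ℝ}
    (hG : Continuous fun q : ℝ × ℝ × ℝ => G q.1 q.2.1 q.2.2) {K : ℝ}
    (hK : ∀ x s l, |G x s l| ≤ K) {L : ℝ} {Q : Set (ℝ × ℝ)} (hQ : IsClosed Q)
    (hQL : ∀ q ∈ Q, |q.1| ≤ L ∧ |q.2| ≤ L) {O : Set Xsp} (hO : IsOpen O)
    (h : ∀ z ∈ delaySol p G 0, (z.1, z.2.2 0) ∈ Q → z ∈ O) :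
    ∃ ε > 0, ∀ h, 0 ≤ h → h < ε → ∀ z ∈ delaySol p G h, (z.1, z.2.2 0) ∈ Q → z ∈ O := by
  obtain ⟨S, hS, hS'⟩ := exists_isCompact_delaySol hp hG hK L
  let T : Set (ℝ × Xsp) := (Icc 0 1 ×ˢ S) ∩ ({y : ℝ × Xsp | y.2 ∈ delaySol p G y.1} ∩
    ((fun y : ℝ × Xsp => (y.2.1, y.2.2.2 0)) ⁻¹' Q ∩ (Prod.snd ⁻¹' Oᶜ)))
  have hT : IsCompact T := (isCompact_Icc.prod hS).inter_right ((isClosed_delaySol hp hG).inter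
    ((hQ.preimage (by fun_prop)).inter (hO.isClosed_compl.preimage continuous_snd)))
  have hT' : IsClosed (Prod.fst '' T) := (hT.image continuous_fst).isClosed
  have h0 : (0:ℝ) ∉ Prod.fst '' T := by
    rintro ⟨⟨y, z⟩, ⟨-, h1, h2, h3⟩, rfl⟩
    exact h3 (h z h1 h2)
  obtain ⟨ε, hε, hb⟩ := Metric.isOpen_iff.1 hT'.isOpen_compl 0 h0
  refine ⟨min ε 1, by positivity, fun η hη hlt z hz hzQ => ?_⟩
  by_contra hzO
  have : η ∈ Metric.ball (0:ℝ) ε := by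
    rw [mem_ball_zero_iff, Real.norm_eq_abs, abs_of_nonneg hη]
    exact hlt.trans_le (min_le_left _ _)
  refine hb this ⟨(η, z), ⟨⟨⟨hη, (hlt.trans_le (min_le_right _ _)).le⟩, ?_⟩, hz, hzQ, hzO⟩, rfl⟩
  exact hS' η z hz (hQL _ hzQ).1 (hQL _ hzQ).2

end Shooting

section Tonelli

variable {p : ℝ}

/-- `φ_p(u')` for the delayed problem with history `U`, parameter `q.1` and slope `q.2` at `0`. -/
noncomputable def tonelliFlux (p : ℝ) (G : ℝ → ℝ → ℝ → ℝ) (h : ℝ) (U : ℝ × ℝ → ℝ → ℝ)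
    (q : ℝ × ℝ) (x : ℝ) : ℝ :=
  phip p q.2 - ∫ t in (0:ℝ)..x, G t (U q (max 0 (t - h))) q.1

/-- iterates of the solution operator of the delayed problem. -/
noncomputable def tonelliIter (p : ℝ) (G : ℝ → ℝ → ℝ → ℝ) (h : ℝ) : ℕ → ℝ × ℝ → ℝ → ℝ
  | 0 => fun _ _ => 0
  | m + 1 => fun q x =>
    ∫ t in (0:ℝ)..x, phip (p / (p - 1)) (tonelliFlux p G h (tonelliIter p G h m) q t)

variable {G : ℝ → ℝ → ℝ → ℝ} (hG : Continuous fun q : ℝ × ℝ × ℝ => G q.1 q.2.1 q.2.2)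

include hG in
lemma continuous_tonelliFlux (hp : 1 < p) (h : ℝ) {U : ℝ × ℝ → ℝ → ℝ}
    (hU : Continuous U.uncurry) : Continuous (tonelliFlux p G h U).uncurry := by
  have hφ := continuous_phip hp
  have h1 : Continuous fun r : (ℝ × ℝ) × ℝ => (r.2, U.uncurry (r.1, max 0 (r.2 - h)), r.1.1) := by
    fun_prop
  have := intervalIntegral.continuous_parametric_primitive_of_continuous (μ := MeasureTheory.volume)
    (f := fun (q : ℝ × ℝ) t => G t (U q (max 0 (t - h))) q.1) (a₀ := 0) (hG.comp h1)
  exact (hφ.comp (continuous_snd.comp continuous_fst)).sub this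

include hG in
lemma continuous_tonelliIter (hp : 1 < p) (h : ℝ) (m : ℕ) :
    Continuous (tonelliIter p G h m).uncurry := by
  induction m with
  | zero => exact continuous_const
  | succ m ih =>
    exact intervalIntegral.continuous_parametric_primitive_of_continuous
      (μ := MeasureTheory.volume)
      (f := fun (q : ℝ × ℝ) t => phip (p / (p - 1)) (tonelliFlux p G h (tonelliIter p G h m) q t))
      (a₀ := 0) ((continuous_phip (one_lt_conj hp)).comp (continuous_tonelliFlux hG hp h ih))

lemma tonelliIter_succ_eq {h : ℝ} (hh : 0 ≤ h) (q : ℝ × ℝ) (m : ℕ) :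
    ∀ x ∈ Icc (0:ℝ) (m * h), tonelliIter p G h (m + 1) q x = tonelliIter p G h m q x := by
  induction m with
  | zero =>
    intro x hx
    obtain rfl : x = 0 := by simpa using hx
    simp [tonelliIter]
  | succ m ih =>
    intro x hx
    rw [tonelliIter, tonelliIter]
    refine intervalIntegral.integral_congr fun t ht => ?_
    rw [uIcc_of_le hx.1] at ht
    simp only [tonelliFlux]
    congr 2
    refine intervalIntegral.integral_congr fun s hs => ?_
    rw [uIcc_of_le ht.1] at hs
    refine congrArg (fun y => G s y q.1) (ih _ ⟨le_max_left _ _, max_le (by positivity) ?_⟩)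
    have := hs.2.trans (ht.2.trans hx.2)
    push_cast at this
    linarith

lemma exists_continuousMap_apply_eq {f : ℝ × ℝ → ℝ → ℝ} (hf : Continuous f.uncurry) :
    ∃ F : C(ℝ × ℝ, CI), ∀ q (x : Icc (0:ℝ) 1), F q x = f q x := by
  have h1 : Continuous fun r : (ℝ × ℝ) × Icc (0:ℝ) 1 => (r.1, (r.2:ℝ)) := by fun_prop
  exact ⟨ContinuousMap.curry ⟨_, hf.comp h1⟩, fun q x => rfl⟩

include hG in
/-- The delayed problem has a solution depending continuously on the parameter and the slope. -/
lemma exists_continuous_delaySol (hp : 1 < p) {h : ℝ} (hh : 0 < h) :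
    ∃ Z : ℝ × ℝ → Xsp, Continuous Z ∧
      ∀ q, (Z q).1 = q.1 ∧ (Z q).2.2 0 = q.2 ∧ Z q ∈ delaySol p G h := by
  obtain ⟨n, hn⟩ := exists_nat_ge (1 / h)
  have hn1 : 1 ≤ n * h := by rwa [div_le_iff₀ hh] at hn
  let U := tonelliIter p G h n
  have hU : Continuous U.uncurry := continuous_tonelliIter hG hp h n
  have hW := continuous_tonelliFlux hG hp h hU
  have hVc : Continuous fun r : (ℝ × ℝ) × ℝ =>
      phip (p / (p - 1)) (tonelliFlux p G h U r.1 r.2) :=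
    (continuous_phip (one_lt_conj hp)).comp hW
  obtain ⟨UU, hUU⟩ := exists_continuousMap_apply_eq hU
  obtain ⟨VV, hVV⟩ := exists_continuousMap_apply_eq (f := fun q x =>
    phip (p / (p - 1)) (tonelliFlux p G h U q x)) hVc
  refine ⟨fun q => (q.1, UU q, VV q), continuous_fst.prodMk (UU.continuous.prodMk VV.continuous),
    fun q => ?_⟩
  have h0 : VV q 0 = q.2 := by
    rw [hVV]
    simp [tonelliFlux, phip_phip_conj hp]
  refine ⟨rfl, h0, ?_, fun x => ?_⟩
  · intro x
    show UU q x = ∫ t in (0:ℝ)..x, VV q (pI t)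
    rw [hUU, show U q x = _ from (tonelliIter_succ_eq hh.le q n x ⟨x.2.1, x.2.2.trans hn1⟩).symm,
      tonelliIter]
    refine intervalIntegral.integral_congr fun t ht => ?_
    rw [uIcc_of_le x.2.1] at ht
    simp only [hVV]
    rw [pI, projIcc_of_mem _ ⟨ht.1, ht.2.trans x.2.2⟩]
  · show phip p (VV q x) = phip p (VV q 0) - ∫ t in (0:ℝ)..x, G t (UU q (pI (t - h))) q.1
    rw [h0, hVV, phip_conj_phip hp, tonelliFlux]
    congr 1
    refine intervalIntegral.integral_congr fun t ht => ?_
    rw [uIcc_of_le x.2.1] at ht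
    simp only [hUU]
    congr 2
    have : t ≤ 1 := ht.2.trans x.2.2
    rw [coe_projIcc, min_eq_right (by linarith)]

end Tonelli

section Regularity

variable {p : ℝ} {G : ℝ → ℝ → ℝ → ℝ}

lemma exists_reprE_of_delaySol {z : Xsp} {h : ℝ} (hz : z ∈ delaySol p G h) :
    ∃ u : ℝ → ℝ, ContDiff ℝ 1 u ∧ u 0 = 0 ∧ ReprE u z.2 ∧ ∀ x, deriv u x = z.2.2 (pI x) := by
  have hpi : Continuous pI := continuous_projIcc
  have hV : Continuous fun t => z.2.2 (pI t) := by fun_prop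
  have hd : ∀ x, HasDerivAt (fun x => ∫ t in (0:ℝ)..x, z.2.2 (pI t)) (z.2.2 (pI x)) x := fun x =>
    intervalIntegral.integral_hasDerivAt_right (hV.intervalIntegrable _ _)
      hV.stronglyMeasurable.stronglyMeasurableAtFilter hV.continuousAt
  refine ⟨fun x => ∫ t in (0:ℝ)..x, z.2.2 (pI t), ?_, by simp, ⟨hz.1, fun x => ?_⟩,
    fun x => (hd x).deriv⟩
  · rw [contDiff_one_iff_deriv]
    refine ⟨fun x => (hd x).differentiableAt, ?_⟩
    rw [show deriv _ = _ from funext fun x => (hd x).deriv]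
    exact hV
  · rw [(hd x).deriv]; congr; exact (projIcc_val _ _).symm

lemma hasDerivAt_of_delaySol (hG : Continuous fun q : ℝ × ℝ × ℝ => G q.1 q.2.1 q.2.2) {z : Xsp}
    (hz : z ∈ delaySol p G 0) {u : ℝ → ℝ} (hu : ReprE u z.2) :
    ∀ x ∈ Ioo (0:ℝ) 1, HasDerivAt (fun y => phip p (deriv u y)) (-G x (u x) z.1) x := by
  intro x hx
  have hpi : Continuous pI := continuous_projIcc
  have hg : Continuous fun t => G t (z.2.1 (pI (t - 0))) z.1 := by
    have : Continuous fun t => (t, z.2.1 (pI (t - 0)), z.1) := by fun_prop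
    exact hG.comp this
  have hd : HasDerivAt (fun x => ∫ t in (0:ℝ)..x, G t (z.2.1 (pI (t - 0))) z.1)
      (G x (z.2.1 (pI (x - 0))) z.1) x :=
    intervalIntegral.integral_hasDerivAt_right (hg.intervalIntegrable _ _)
      hg.stronglyMeasurable.stronglyMeasurableAtFilter hg.continuousAt
  have hxI := Ioo_subset_Icc_self hx
  rw [sub_zero, pI, projIcc_of_mem _ hxI, hu.1] at hd
  refine (hd.const_sub (phip p (z.2.2 0))).congr_of_eventuallyEq ?_
  filter_upwards [Ioo_mem_nhds hx.1 hx.2] with y hy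
  have := hz.2 ⟨y, Ioo_subset_Icc_self hy⟩
  rw [hu.2] at this
  exact this

lemma mem_delaySol_of_hasDerivAt (hp : 1 < p)
    (hG : Continuous fun q : ℝ × ℝ × ℝ => G q.1 q.2.1 q.2.2) {z : Xsp}
    {u : ℝ → ℝ} (hC : ContDiff ℝ 1 u) (h0 : u 0 = 0) (hu : ReprE u z.2)
    (hd : ∀ x ∈ Ioo (0:ℝ) 1, HasDerivAt (fun y => phip p (deriv u y)) (-G x (u x) z.1) x) :
    z ∈ delaySol p G 0 := by
  have hcd := hC.continuous_deriv le_rfl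
  refine ⟨fun x => ?_, fun x => ?_⟩
  · rw [hu.1]
    have := intervalIntegral.integral_eq_sub_of_hasDerivAt (f := u) (f' := deriv u) (a := 0) (b := x)
      (fun t _ => ((hC.differentiable one_ne_zero) t).hasDerivAt) (hcd.intervalIntegrable _ _)
    rw [h0, sub_zero] at this
    rw [← this]
    refine intervalIntegral.integral_congr fun t ht => ?_
    rw [uIcc_of_le x.2.1] at ht
    rw [pI, projIcc_of_mem _ ⟨ht.1, ht.2.trans x.2.2⟩, hu.2]
  · have hg : Continuous fun t => -G t (u t) z.1 := by
      have : Continuous fun t => (t, u t, z.1) := by have := hC.continuous; fun_prop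
      exact (hG.comp this).neg
    have := intervalIntegral.integral_eq_sub_of_hasDerivAt_of_le (f := fun y => phip p (deriv u y))
      (f' := fun t => -G t (u t) z.1) (a := 0) (b := x) x.2.1
      ((continuous_phip hp).comp hcd).continuousOn
      (fun t ht => hd t ⟨ht.1, ht.2.trans_le x.2.2⟩) (hg.intervalIntegrable _ _)
    rw [hu.2, hu.2]
    have e : ∫ t in (0:ℝ)..x, G t (z.2.1 (pI (t - 0))) z.1 = ∫ t in (0:ℝ)..x, G t (u t) z.1 := by
      refine intervalIntegral.integral_congr fun t ht => ?_
      rw [uIcc_of_le x.2.1] at ht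
      rw [sub_zero, pI, projIcc_of_mem _ ⟨ht.1, ht.2.trans x.2.2⟩, hu.1]
    rw [e]
    rw [intervalIntegral.integral_neg] at this
    show phip p (deriv u x) = phip p (deriv u ((0 : Icc (0:ℝ) 1) : ℝ)) - _
    rw [Icc.coe_zero]
    linarith

lemma eq_zero_on_of_abs_deriv_le {E E' : ℝ → ℝ} {K : ℝ} (hE : ContinuousOn E (Icc 0 1))
    (hE0 : ∀ x, 0 ≤ E x) (hd : ∀ x ∈ Ioo (0:ℝ) 1, HasDerivAt E (E' x) x)
    (hb : ∀ x ∈ Ioo (0:ℝ) 1, |E' x| ≤ K * E x) {x₀ : ℝ} (hx₀ : x₀ ∈ Icc (0:ℝ) 1)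
    (h0 : E x₀ = 0) : ∀ x ∈ Icc (0:ℝ) 1, E x = 0 := by
  have hexp : ∀ c x : ℝ, HasDerivAt (fun y => Real.exp (c * y)) (Real.exp (c * x) * c) x :=
    fun c x => by simpa using ((hasDerivAt_id x).const_mul c).exp
  have hder : ∀ c : ℝ, ∀ x ∈ Ioo (0:ℝ) 1, HasDerivAt (fun y => Real.exp (c * y) * E y)
      (Real.exp (c * x) * (c * E x + E' x)) x := fun c x hx =>
    ((hexp c x).mul (hd x hx)).congr_deriv (by ring)
  have hcont : ∀ c : ℝ, ContinuousOn (fun y => Real.exp (c * y) * E y) (Icc 0 1) := fun c =>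
    ContinuousOn.mul (by fun_prop) hE
  have hanti : AntitoneOn (fun y => Real.exp (-K * y) * E y) (Icc 0 1) := by
    refine antitoneOn_of_deriv_nonpos (convex_Icc _ _) (hcont _) (fun x hx => ?_) (fun x hx => ?_)
    all_goals rw [interior_Icc] at hx
    · exact (hder _ x hx).differentiableAt.differentiableWithinAt
    · rw [(hder _ x hx).deriv]
      have := (abs_le.1 (hb x hx)).2
      exact mul_nonpos_of_nonneg_of_nonpos (Real.exp_pos _).le (by linarith)
  have hmono : MonotoneOn (fun y => Real.exp (K * y) * E y) (Icc 0 1) := by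
    refine monotoneOn_of_deriv_nonneg (convex_Icc _ _) (hcont _) (fun x hx => ?_) (fun x hx => ?_)
    all_goals rw [interior_Icc] at hx
    · exact (hder _ x hx).differentiableAt.differentiableWithinAt
    · rw [(hder _ x hx).deriv]
      have := (abs_le.1 (hb x hx)).1
      exact mul_nonneg (Real.exp_pos _).le (by linarith)
  intro x hx
  refine le_antisymm ?_ (hE0 x)
  rcases le_total x₀ x with h | h
  · have := hanti hx₀ hx h
    simp only [h0, mul_zero] at this
    exact nonpos_of_mul_nonpos_right this (Real.exp_pos _)
  · have := hmono hx hx₀ h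
    simp only [h0, mul_zero] at this
    exact nonpos_of_mul_nonpos_right this (Real.exp_pos _)

/-- Solutions of the truncated problem with a double zero are trivial. -/
lemma phaseCurve_ne_zero_of_delaySol (hp : 1 < p)
    (hG : Continuous fun q : ℝ × ℝ × ℝ => G q.1 q.2.1 q.2.2) {C : ℝ}
    (hC : ∀ x s l, |G x s l| ≤ C * |s| ^ (p - 1)) {z : Xsp}
    (hz : z ∈ delaySol p G 0) (hne : z.2 ≠ 0) : ∀ x, phaseCurve hp z.2 x ≠ 0 := by
  intro x₀
  rw [phaseCurve_ne_zero_iff]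
  intro hU hV
  refine hne ?_
  obtain ⟨u, hu, hu0, hr, -⟩ := exists_reprE_of_delaySol hz
  have hw := hasDerivAt_of_delaySol hG hz hr
  have hdu : ∀ x, HasDerivAt u (deriv u x) x := fun x =>
    ((hu.differentiable one_ne_zero) x).hasDerivAt
  have hp0 : 0 < p := by linarith
  have hp1 : 0 < p - 1 := by linarith
  let q := p / (p - 1)
  have hq : 1 < q := one_lt_conj hp
  let E : ℝ → ℝ := fun x => |u x| ^ p + |phip p (deriv u x)| ^ q
  have hC0 : 0 ≤ C := by simpa using (abs_nonneg _).trans (hC 0 1 0)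
  have hpow : ∀ s : ℝ, |phip p s| ^ q = |s| ^ p := fun s => by
    rw [abs_phip hp, ← Real.rpow_mul (abs_nonneg _)]
    congr 1
    simp only [q]
    field_simp
  have hcE : Continuous E := by
    refine (hu.continuous.abs.rpow_const fun _ => Or.inr hp0.le).add ?_
    exact ((continuous_phip hp).comp (hu.continuous_deriv le_rfl)).abs.rpow_const
      fun _ => Or.inr (by linarith)
  have key := eq_zero_on_of_abs_deriv_le (E := E) (K := p + q * C) (x₀ := x₀)
    (E' := fun x => p * phip p (u x) * deriv u x + q * deriv u x * (-G x (u x) z.1))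
    hcE.continuousOn (fun x => by positivity) (fun x hx => ?_) (fun x hx => ?_) x₀.2 ?_
  · have hU0 : ∀ x ∈ Icc (0:ℝ) 1, u x = 0 ∧ deriv u x = 0 := fun x hx => by
      have h1 := key x hx
      simp only [E, hpow] at h1
      have h2 : |u x| ^ p = 0 := by
        refine le_antisymm ?_ (by positivity)
        have : 0 ≤ |deriv u x| ^ p := by positivity
        linarith
      have h3 : |deriv u x| ^ p = 0 := by linarith
      rw [Real.rpow_eq_zero (abs_nonneg _) hp0.ne', abs_eq_zero] at h2 h3
      exact ⟨h2, h3⟩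
    refine Prod.ext ?_ ?_ <;> ext x
    · rw [hr.1]; exact (hU0 x x.2).1
    · rw [hr.2]; exact (hU0 x x.2).2
  · have h1 := (hasDerivAt_abs_rpow_phip hp (u x)).comp x (hdu x)
    have h2 := (hasDerivAt_abs_rpow_phip hq (phip p (deriv u x))).comp x (hw x hx)
    refine (h1.add h2).congr_deriv ?_
    rw [phip_phip_conj hp]
  · simp only [E, hpow]
    have hmix : |u x| ^ (p - 1) * |deriv u x| ≤ |u x| ^ p + |deriv u x| ^ p := by
      have hpw : ∀ s : ℝ, |s| ^ (p - 1) * |s| = |s| ^ p := fun s => by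
        rw [← abs_phip hp, ← abs_mul, phip_mul_self hp, abs_of_nonneg (by positivity)]
      rcases le_total |u x| |deriv u x| with h | h
      · calc |u x| ^ (p - 1) * |deriv u x| ≤ |deriv u x| ^ (p - 1) * |deriv u x| := by gcongr
          _ = |deriv u x| ^ p := hpw _
          _ ≤ _ := le_add_of_nonneg_left (by positivity)
      · calc |u x| ^ (p - 1) * |deriv u x| ≤ |u x| ^ (p - 1) * |u x| := by gcongr
          _ = |u x| ^ p := hpw _
          _ ≤ _ := le_add_of_nonneg_right (by positivity)
    calc |p * phip p (u x) * deriv u x + q * deriv u x * (-G x (u x) z.1)|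
        ≤ |p * phip p (u x) * deriv u x| + |q * deriv u x * (-G x (u x) z.1)| := abs_add_le _ _
      _ = p * (|u x| ^ (p - 1) * |deriv u x|) + q * |deriv u x| * |G x (u x) z.1| := by
          simp only [abs_mul, abs_neg, abs_phip hp, abs_of_pos hp0,
            abs_of_pos (zero_lt_one.trans hq)]
          ring
      _ ≤ p * (|u x| ^ (p - 1) * |deriv u x|) + q * |deriv u x| * (C * |u x| ^ (p - 1)) := by
          gcongr; exact hC _ _ _
      _ = (p + q * C) * (|u x| ^ (p - 1) * |deriv u x|) := by ring
      _ ≤ _ := by gcongr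
  · simp only [E, hpow]
    rw [← hr.1, ← hr.2, hU, hV]
    simp [Real.zero_rpow hp0.ne']

end Regularity

section Truncation

variable {p : ℝ}

/-- truncation of `s` at levels `±b`. -/
def clampAt (b s : ℝ) : ℝ := max (-b) (min b s)

lemma continuous_clampAt : Continuous fun q : ℝ × ℝ => clampAt q.1 q.2 := by
  unfold clampAt; fun_prop

lemma clampAt_eq {b s : ℝ} (h : |s| ≤ b) : clampAt b s = s := by
  obtain ⟨h1, h2⟩ := abs_le.1 h
  rw [clampAt, min_eq_right h2, max_eq_right h1]

lemma abs_clampAt_le {b : ℝ} (hb : 0 ≤ b) (s : ℝ) : |clampAt b s| ≤ b :=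
  abs_le.2 ⟨le_max_left _ _, max_le (by linarith) (min_le_left _ _)⟩

lemma abs_clampAt_le_abs {b : ℝ} (hb : 0 ≤ b) (s : ℝ) : |clampAt b s| ≤ |s| := by
  by_cases h : |s| ≤ b
  · rw [clampAt_eq h]
  · exact (abs_clampAt_le hb s).trans (not_le.1 h).le

/-- the barrier `R * dist x {0, 1}` that a `C¹` function with derivative bounded by `R` and
vanishing at the end points satisfies. -/
def hat (R x : ℝ) : ℝ := R * min x (1 - x)

lemma hat_nonneg {R x : ℝ} (hR : 0 ≤ R) (hx : x ∈ Icc (0:ℝ) 1) : 0 ≤ hat R x :=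
  mul_nonneg hR (le_min hx.1 (by linarith [hx.2]))

lemma hat_le {R x : ℝ} (hR : 0 ≤ R) (hx : x ∈ Icc (0:ℝ) 1) : hat R x ≤ R :=
  mul_le_of_le_one_right hR ((min_le_left _ _).trans hx.2)

lemma exists_growth_bound (hp : 1 < p) {F : ℝ → ℝ → ℝ → ℝ}
    (hF : ContinuousOn (fun q : ℝ × ℝ × ℝ => F q.1 q.2.1 q.2.2)
      (Ioo (0:ℝ) 1 ×ˢ (univ : Set (ℝ × ℝ)))) {L R C₀ δ : ℝ} (hR : 0 < R) (hδ : 0 < δ)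
    (hC₀ : 0 ≤ C₀)
    (hsmall : ∀ x ∈ Ioo (0:ℝ) 1, ∀ s, 0 < |s| → |s| < δ → ∀ l, |l| ≤ L →
      |F x s l| ≤ C₀ * |s| ^ (p - 1)) :
    (∀ x ∈ Ioo (0:ℝ) 1, ∀ l, |l| ≤ L → F x 0 l = 0) ∧
    ∃ C, 0 ≤ C ∧ ∀ x ∈ Ioo (0:ℝ) 1, ∀ s, |s| ≤ hat R x → ∀ l, |l| ≤ L →
      |F x s l| ≤ C * |s| ^ (p - 1) := by
  have hp1 : 0 < p - 1 := by linarith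
  have hz : ∀ x ∈ Ioo (0:ℝ) 1, ∀ l, |l| ≤ L → F x 0 l = 0 := by
    intro x hx l hl
    have hc : Continuous fun s => F x s l := by
      have h1 : Continuous fun s : ℝ => (x, s, l) := by fun_prop
      exact hF.comp_continuous h1 fun s => ⟨hx, trivial⟩
    have h1 : Tendsto (fun s => F x s l) (𝓝[≠] 0) (𝓝 (F x 0 l)) :=
      (hc.tendsto 0).mono_left nhdsWithin_le_nhds
    have hcp : Continuous fun s : ℝ => C₀ * |s| ^ (p - 1) :=
      continuous_const.mul (continuous_abs.rpow_const fun _ => Or.inr hp1.le)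
    have h2 : Tendsto (fun s : ℝ => C₀ * |s| ^ (p - 1)) (𝓝[≠] 0) (𝓝 0) := by
      have := hcp.tendsto 0
      simp only [abs_zero, Real.zero_rpow hp1.ne', mul_zero] at this
      exact this.mono_left nhdsWithin_le_nhds
    refine tendsto_nhds_unique h1 (squeeze_zero_norm' ?_ h2)
    filter_upwards [self_mem_nhdsWithin, mem_nhdsWithin_of_mem_nhds (Metric.ball_mem_nhds 0 hδ)]
      with s hs hs'
    exact hsmall x hx s (abs_pos.2 hs) (by simpa using hs') l hl
  refine ⟨hz, ?_⟩
  have hcomp : IsCompact (Icc (δ / R) (1 - δ / R) ×ˢ Icc (-R) R ×ˢ Icc (-L) L) :=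
    isCompact_Icc.prod (isCompact_Icc.prod isCompact_Icc)
  have hδR : 0 < δ / R := by positivity
  obtain ⟨K, hK⟩ := hcomp.exists_bound_of_continuousOn (hF.mono (by
    rintro ⟨x, s, l⟩ ⟨hx, -⟩
    exact ⟨⟨hδR.trans_le hx.1, hx.2.trans_lt (by linarith)⟩, trivial⟩))
  have hδp : 0 < δ ^ (p - 1) := Real.rpow_pos_of_pos hδ _
  refine ⟨max C₀ (|K| / δ ^ (p - 1)), le_max_of_le_left hC₀, fun x hx s hs l hl => ?_⟩
  rcases eq_or_ne s 0 with rfl | hs0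
  · rw [hz x hx l hl, abs_zero, Real.zero_rpow hp1.ne', mul_zero]
  rcases lt_or_ge |s| δ with h | h
  · refine (hsmall x hx s (abs_pos.2 hs0) h l hl).trans ?_
    gcongr
    exact le_max_left _ _
  · have hxI := Ioo_subset_Icc_self hx
    have h1 : δ / R ≤ min x (1 - x) := by
      rw [div_le_iff₀ hR, mul_comm]; exact h.trans hs
    have h2 := hK (x, s, l) ⟨⟨h1.trans (min_le_left _ _), by
      have := h1.trans (min_le_right _ _); linarith⟩, abs_le.1 (hs.trans (hat_le hR.le hxI)),
      abs_le.1 hl⟩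
    calc |F x s l| ≤ |K| := h2.trans (le_abs_self K)
      _ = |K| / δ ^ (p - 1) * δ ^ (p - 1) := by field_simp
      _ ≤ max C₀ (|K| / δ ^ (p - 1)) * |s| ^ (p - 1) := by
        gcongr
        exact le_max_right _ _

open Classical in
lemma continuous_truncation (hp : 1 < p) {F : ℝ → ℝ → ℝ → ℝ}
    (hF : ContinuousOn (fun q : ℝ × ℝ × ℝ => F q.1 q.2.1 q.2.2)
      (Ioo (0:ℝ) 1 ×ˢ (univ : Set (ℝ × ℝ)))) {L R C : ℝ} (hR : 0 ≤ R) (hL : 0 ≤ L) (hC0 : 0 ≤ C)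
    (hC : ∀ x ∈ Ioo (0:ℝ) 1, ∀ s, |s| ≤ hat R x → ∀ l, |l| ≤ L → |F x s l| ≤ C * |s| ^ (p - 1)) :
    Continuous fun q : ℝ × ℝ × ℝ =>
      if q.1 ∈ Ioo (0:ℝ) 1 then F q.1 (clampAt (hat R q.1) q.2.1) (clampAt L q.2.2) else 0 := by
  have hp1 : 0 < p - 1 := by linarith
  have hcl := continuous_clampAt
  have hhat : Continuous (hat R) := by unfold hat; fun_prop
  rw [continuous_iff_continuousAt]
  rintro ⟨x, s, l⟩
  by_cases hx : x ∈ Ioo (0:ℝ) 1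
  · have hm : Continuous fun q : ℝ × ℝ × ℝ => (q.1, clampAt (hat R q.1) q.2.1, clampAt L q.2.2) := by
      have h1 : Continuous fun q : ℝ × ℝ × ℝ => (hat R q.1, q.2.1) := by fun_prop
      have h2 : Continuous fun q : ℝ × ℝ × ℝ => (L, q.2.2) := by fun_prop
      exact continuous_fst.prodMk ((hcl.comp h1).prodMk (hcl.comp h2))
    have hop : IsOpen (Ioo (0:ℝ) 1 ×ˢ (univ : Set (ℝ × ℝ))) := isOpen_Ioo.prod isOpen_univ
    have h1 := ContinuousAt.comp (x := (x, s, l)) (hF.continuousAt (hop.mem_nhds ⟨hx, trivial⟩))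
      hm.continuousAt
    refine h1.congr ?_
    filter_upwards [hop.mem_nhds (show (x, s, l) ∈ _ from ⟨hx, trivial⟩)] with q hq
    simp only [Function.comp_apply, if_pos hq.1]
  · have h0 : (0:ℝ) = (if (x, s, l).1 ∈ Ioo (0:ℝ) 1 then
        F (x, s, l).1 (clampAt (hat R (x, s, l).1) (x, s, l).2.1) (clampAt L (x, s, l).2.2) else 0) :=
      (if_neg hx).symm
    rw [ContinuousAt, ← h0]
    have hbc : Continuous fun q : ℝ × ℝ × ℝ => C * |max 0 (hat R q.1)| ^ (p - 1) := by
      refine continuous_const.mul (Continuous.rpow_const ?_ fun _ => Or.inr hp1.le)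
      fun_prop
    have hb := hbc.tendsto (x, s, l)
    have hneg : hat R x ≤ 0 := by
      refine mul_nonpos_of_nonneg_of_nonpos hR ?_
      by_contra! hcon
      exact hx ⟨hcon.trans_le (min_le_left _ _), by
        have := hcon.trans_le (min_le_right _ _); linarith⟩
    simp only [max_eq_left hneg, abs_zero, Real.zero_rpow hp1.ne', mul_zero] at hb
    refine squeeze_zero_norm (fun q => ?_) hb
    by_cases hq : q.1 ∈ Ioo (0:ℝ) 1
    · have hq0 := hat_nonneg hR (Ioo_subset_Icc_self hq)
      have hcb := abs_clampAt_le hq0 q.2.1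
      rw [if_pos hq, max_eq_right hq0, Real.norm_eq_abs, abs_of_nonneg hq0]
      refine (hC _ hq _ hcb _ (abs_clampAt_le hL _)).trans ?_
      exact mul_le_mul_of_nonneg_left (Real.rpow_le_rpow (abs_nonneg _) hcb hp1.le) hC0
    · rw [if_neg hq, norm_zero]; positivity

open Classical in
/-- A globally bounded and continuous modification of the nonlinearity which agrees with it for all
functions whose `C¹` norm and parameter are bounded by `R` and `L`. -/
lemma exists_truncation (hp : 1 < p) {a : ℝ → ℝ} (ha : ContinuousOn a (Icc 0 1))
    {F : ℝ → ℝ → ℝ → ℝ}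
    (hF : ContinuousOn (fun q : ℝ × ℝ × ℝ => F q.1 q.2.1 q.2.2)
      (Ioo (0:ℝ) 1 ×ˢ (univ : Set (ℝ × ℝ)))) {M : ℝ} (hM : 0 < M) {L R : ℝ} (hR : 0 < R)
    (hL : 0 ≤ L)
    (hsmall : ∀ η > 0, ∃ δ > 0, ∀ x ∈ Ioo (0:ℝ) 1, ∀ s, 0 < |s| → |s| < δ → ∀ l, |l| ≤ L →
      |F x s l| ≤ (M + η) * |s| ^ (p - 1)) :
    ∃ G : ℝ → ℝ → ℝ → ℝ, (Continuous fun q : ℝ × ℝ × ℝ => G q.1 q.2.1 q.2.2) ∧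
      (∃ K, ∀ x s l, |G x s l| ≤ K) ∧ (∃ C, ∀ x s l, |G x s l| ≤ C * |s| ^ (p - 1)) ∧
      (∀ η > 0, ∃ δ > 0, ∀ x ∈ Ioo (0:ℝ) 1, ∀ s, |s| ≤ δ → ∀ l, |l| ≤ L →
        |G x s l - l * a x * phip p s| ≤ (M + η) * |s| ^ (p - 1)) ∧
      (∀ x ∈ Ioo (0:ℝ) 1, ∀ s, |s| ≤ hat R x → ∀ l, |l| ≤ L →
        G x s l = l * a x * phip p s + F x s l) := by
  have hp1 : 0 < p - 1 := by linarith
  obtain ⟨δ₁, hδ₁, hs₁⟩ := hsmall 1 one_pos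
  obtain ⟨hz, C, hC0, hC⟩ := exists_growth_bound hp hF hR hδ₁ (by positivity) hs₁
  let H : ℝ → ℝ → ℝ → ℝ := fun x s l =>
    if x ∈ Ioo (0:ℝ) 1 then F x (clampAt (hat R x) s) (clampAt L l) else 0
  have hH : Continuous fun q : ℝ × ℝ × ℝ => H q.1 q.2.1 q.2.2 :=
    continuous_truncation hp hF hR.le hL hC0 hC
  have hHb : ∀ x s l, ∃ s', |s'| ≤ |s| ∧ |s'| ≤ R ∧ |H x s l| ≤ C * |s'| ^ (p - 1) := by
    intro x s l
    by_cases hx : x ∈ Ioo (0:ℝ) 1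
    · have hxI := Ioo_subset_Icc_self hx
      have h0 := hat_nonneg hR.le hxI
      refine ⟨clampAt (hat R x) s, abs_clampAt_le_abs h0 s,
        (abs_clampAt_le h0 s).trans (hat_le hR.le hxI), ?_⟩
      simp only [H, if_pos hx]
      exact hC x hx _ (abs_clampAt_le h0 s) _ (abs_clampAt_le hL l)
    · refine ⟨0, by simp, by simpa using hR.le, ?_⟩
      simp only [H, if_neg hx, abs_zero]
      positivity
  have hac : Continuous fun x => a (pI x) := by
    have h1 : Continuous (Icc (0:ℝ) 1 |>.domRestrict a) := ha.domRestrict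
    exact h1.comp continuous_projIcc
  obtain ⟨A, hA⟩ := isCompact_Icc.exists_bound_of_continuousOn ha
  have hA0 : 0 ≤ A := (norm_nonneg _).trans (hA 0 (by simp))
  let P : ℝ → ℝ → ℝ → ℝ := fun x s l => clampAt L l * a (pI x) * phip p (clampAt R s)
  have hPb : ∀ x s l, |P x s l| ≤ L * A * |clampAt R s| ^ (p - 1) := fun x s l => by
    simp only [P, abs_mul, abs_phip hp]
    gcongr
    · exact abs_clampAt_le hL l
    · exact hA _ (pI x).2
  have hPc : Continuous fun q : ℝ × ℝ × ℝ => P q.1 q.2.1 q.2.2 := by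
    have h1 : Continuous fun q : ℝ × ℝ × ℝ => (L, q.2.2) := by fun_prop
    have h2 : Continuous fun q : ℝ × ℝ × ℝ => (R, q.2.1) := by fun_prop
    exact ((continuous_clampAt.comp h1).mul (hac.comp continuous_fst)).mul
      ((continuous_phip hp).comp (continuous_clampAt.comp h2))
  have hPeq : ∀ x ∈ Ioo (0:ℝ) 1, ∀ s, |s| ≤ R → ∀ l, |l| ≤ L → P x s l = l * a x * phip p s := by
    intro x hx s hs l hl
    simp only [P, clampAt_eq hs, clampAt_eq hl]
    rw [pI, projIcc_of_mem _ (Ioo_subset_Icc_self hx)]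
  refine ⟨fun x s l => P x s l + H x s l, hPc.add hH, ⟨L * A * R ^ (p - 1) + C * R ^ (p - 1), ?_⟩,
    ⟨L * A + C, ?_⟩, ?_, ?_⟩
  · intro x s l
    obtain ⟨s', -, h2, h3⟩ := hHb x s l
    refine (abs_add_le _ _).trans (add_le_add ((hPb x s l).trans ?_) (h3.trans ?_))
    · exact mul_le_mul_of_nonneg_left
        (Real.rpow_le_rpow (abs_nonneg _) (abs_clampAt_le hR.le s) hp1.le) (by positivity)
    · exact mul_le_mul_of_nonneg_left (Real.rpow_le_rpow (abs_nonneg _) h2 hp1.le) hC0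
  · intro x s l
    obtain ⟨s', h1, -, h3⟩ := hHb x s l
    rw [add_mul]
    refine (abs_add_le _ _).trans (add_le_add ((hPb x s l).trans ?_) (h3.trans ?_))
    · exact mul_le_mul_of_nonneg_left
        (Real.rpow_le_rpow (abs_nonneg _) (abs_clampAt_le_abs hR.le s) hp1.le) (by positivity)
    · exact mul_le_mul_of_nonneg_left (Real.rpow_le_rpow (abs_nonneg _) h1 hp1.le) hC0
  · intro η hη
    obtain ⟨δ, hδ, h⟩ := hsmall η hη
    refine ⟨min (δ / 2) R, by positivity, fun x hx s hs l hl => ?_⟩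
    have hsR := hs.trans (min_le_right _ _)
    have hsδ : |s| < δ := (hs.trans (min_le_left _ _)).trans_lt (by linarith)
    have h0 := hat_nonneg hR.le (Ioo_subset_Icc_self hx)
    simp only [hPeq x hx s hsR l hl, add_sub_cancel_left, H, if_pos hx, clampAt_eq hl]
    have hle := abs_clampAt_le_abs h0 s
    rcases eq_or_ne (clampAt (hat R x) s) 0 with e | e
    · rw [e, hz x hx l hl, abs_zero]; positivity
    · refine (h x hx _ (abs_pos.2 e) (hle.trans_lt hsδ) l hl).trans ?_
      exact mul_le_mul_of_nonneg_left (Real.rpow_le_rpow (abs_nonneg _) hle hp1.le) (by positivity)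
  · intro x hx s hs l hl
    have hxI := Ioo_subset_Icc_self hx
    simp only [hPeq x hx s (hs.trans (hat_le hR.le hxI)) l hl, H, if_pos hx, clampAt_eq hl,
      clampAt_eq hs]

end Truncation

section SmallSolutions

variable {p : ℝ}

lemma exists_reprE {u : ℝ → ℝ} (hu : ContDiff ℝ 1 u) : ∃ w, ReprE u w :=
  ⟨(⟨fun x => u x, hu.continuous.comp continuous_subtype_val⟩,
    ⟨fun x => deriv u x, (hu.continuous_deriv le_rfl).comp continuous_subtype_val⟩),
    fun _ => rfl, fun _ => rfl⟩

lemma isOpen_rotAngle_mem (hp : 1 < p) {S : Set ℝ} (hS : IsOpen S) :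
    IsOpen {z : Xsp | (∀ x, phaseCurve hp z.2 x ≠ 0) ∧ rotAngle (phaseCurve hp z.2) ∈ S} := by
  have hc : Continuous fun z : Xsp => phaseCurve hp z.2 :=
    (continuous_phaseCurve hp).comp continuous_snd
  have h1 : IsOpen {γ : C(Icc (0:ℝ) 1, ℂ) | ∀ x, γ x ≠ 0} := by
    have := ContinuousMap.isOpen_setOfPred_mapsTo (X := Icc (0:ℝ) 1) (Y := ℂ) isCompact_univ
      (isOpen_compl_singleton (x := (0:ℂ)))
    convert this using 1
    ext γ
    simp [MapsTo]
  rw [isOpen_iff_mem_nhds]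
  rintro z ⟨hz, hzS⟩
  have h2 : ContinuousAt (fun z : Xsp => rotAngle (phaseCurve hp z.2)) z :=
    ContinuousAt.comp (g := rotAngle) (continuousAt_rotAngle hz) hc.continuousAt
  filter_upwards [(h1.preimage hc).mem_nhds hz, h2 (hS.mem_nhds hzS)] with y hy hy'
  exact ⟨hy, hy'⟩

lemma isOpen_phaseCurve_ne_zero (hp : 1 < p) :
    IsOpen {z : Xsp | ∀ x, phaseCurve hp z.2 x ≠ 0} := by
  simpa using isOpen_rotAngle_mem hp isOpen_univ

lemma isClosed_delaySol_zero (hp : 1 < p) {G : ℝ → ℝ → ℝ → ℝ}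
    (hG : Continuous fun q : ℝ × ℝ × ℝ => G q.1 q.2.1 q.2.2) : IsClosed (delaySol p G 0) := by
  have h : Continuous fun z : Xsp => ((0:ℝ), z) := by fun_prop
  exact (isClosed_delaySol hp hG).preimage h

lemma apply_zero_of_delaySol {G : ℝ → ℝ → ℝ → ℝ} {h : ℝ} {z : Xsp}
    (hz : z ∈ delaySol p G h) : z.2.1 0 = 0 := by
  rw [hz.1]; simp

lemma eq_zero_of_delaySol (hp : 1 < p) {G : ℝ → ℝ → ℝ → ℝ}
    (hG : Continuous fun q : ℝ × ℝ × ℝ => G q.1 q.2.1 q.2.2) {C : ℝ}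
    (hC : ∀ x s l, |G x s l| ≤ C * |s| ^ (p - 1)) {z : Xsp}
    (hz : z ∈ delaySol p G 0) (h0 : z.2.2 0 = 0) : z.2 = 0 := by
  by_contra hne
  exact (phaseCurve_ne_zero_iff hp z.2 0).1 (phaseCurve_ne_zero_of_delaySol hp hG hC hz hne 0)
    (apply_zero_of_delaySol hz) h0

/-- Solutions with small slope at `0` are close to the trivial solution. -/
lemma exists_forall_mem_of_slope_le (hp : 1 < p) {G : ℝ → ℝ → ℝ → ℝ}
    (hG : Continuous fun q : ℝ × ℝ × ℝ => G q.1 q.2.1 q.2.2) {K C : ℝ}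
    (hK : ∀ x s l, |G x s l| ≤ K) (hC : ∀ x s l, |G x s l| ≤ C * |s| ^ (p - 1))
    {b c : ℝ} {O : Set Xsp} (hO : IsOpen O) (h : ∀ l ∈ Icc b c, ((l, 0) : Xsp) ∈ O) :
    ∃ α > 0, ∀ z ∈ delaySol p G 0, z.1 ∈ Icc b c → |z.2.2 0| ≤ α → z ∈ O := by
  obtain ⟨S, hS, hS'⟩ := exists_isCompact_delaySol hp hG hK (max 1 (max |b| |c|))
  let T : Set Xsp := S ∩ (delaySol p G 0 ∩ (Prod.fst ⁻¹' Icc b c ∩ Oᶜ))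
  have hT : IsCompact T := hS.inter_right ((isClosed_delaySol_zero hp hG).inter
    ((isClosed_Icc.preimage continuous_fst).inter hO.isClosed_compl))
  have hTc : IsClosed ((fun z : Xsp => |z.2.2 0|) '' T) := (hT.image (by fun_prop)).isClosed
  have h0 : (0:ℝ) ∉ (fun z : Xsp => |z.2.2 0|) '' T := by
    rintro ⟨z, ⟨-, h1, h2, h3⟩, h4⟩
    have h5 := eq_zero_of_delaySol hp hG hC h1 (abs_eq_zero.1 h4)
    refine h3 ?_
    rw [show z = (z.1, z.2) from rfl, h5]
    exact h _ h2
  obtain ⟨ε, hε, hb⟩ := Metric.isOpen_iff.1 hTc.isOpen_compl 0 h0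
  refine ⟨min (ε / 2) 1, by positivity, fun z hz hzI hz0 => ?_⟩
  by_contra hzO
  refine hb (a := |z.2.2 0|) ?_ ⟨z, ⟨?_, hz, hzI, hzO⟩, rfl⟩
  · rw [mem_ball_zero_iff, Real.norm_eq_abs, abs_abs]
    exact (hz0.trans (min_le_left _ _)).trans_lt (by linarith)
  · refine hS' 0 z hz ((abs_le_max_abs_abs hzI.1 hzI.2).trans (le_max_right _ _))
      (hz0.trans ((min_le_right _ _).trans (le_max_left _ _)))

/-- Small solutions whose parameter is outside a neighbourhood of `I_k` rotate strictly less, or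
strictly more, than the eigenfunction. -/
lemma exists_forall_rotAngle (hp : 1 < p) {a : ℝ → ℝ} {G : ℝ → ℝ → ℝ → ℝ}
    (hG : Continuous fun q : ℝ × ℝ × ℝ => G q.1 q.2.1 q.2.2) {C : ℝ}
    (hC : ∀ x s l, |G x s l| ≤ C * |s| ^ (p - 1)) {M L a0 : ℝ} (hM : 0 < M) (ha0 : 0 < a0)
    (ha : ∀ x ∈ Ioo (0:ℝ) 1, a0 ≤ a x)
    (hGs : ∀ η > 0, ∃ δ > 0, ∀ x ∈ Ioo (0:ℝ) 1, ∀ s, |s| ≤ δ → ∀ l, |l| ≤ L →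
        |G x s l - l * a x * phip p s| ≤ (M + η) * |s| ^ (p - 1))
    {k : ℕ} (hk : 1 ≤ k) {lamk : ℝ} {e : ℝ → ℝ} (he : IsLinSol p a lamk e) (heS : MemS k 1 e)
    {η : ℝ} (hη : 0 < η) :
    ∃ δ > 0, ∀ z ∈ delaySol p G 0, z.2 ≠ 0 → |z.1| ≤ L → (∀ x, |z.2.1 x| ≤ δ) →
      (z.1 ≤ lamk - M / a0 - η → rotAngle (phaseCurve hp z.2) < k * Real.pi) ∧
      (lamk + M / a0 + η ≤ z.1 → k * Real.pi < rotAngle (phaseCurve hp z.2)) := by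
  obtain ⟨δ, hδ, hs⟩ := hGs (η * a0 / 2) (by positivity)
  obtain ⟨we, hwe⟩ := exists_reprE he.1.1
  have hene := hwe.phaseCurve_ne_zero hp heS.2.2.2.1
  have herot := heS.rotAngle_eq hp hk hwe
  refine ⟨δ, hδ, fun z hz hzne hzL hzδ => ?_⟩
  obtain ⟨u, hu, hu0, hr, -⟩ := exists_reprE_of_delaySol hz
  have hne := phaseCurve_ne_zero_of_delaySol hp hG hC hz hzne
  let cu : ℝ → ℝ := fun x => G x (u x) z.1 / phip p (u x)
  have hw : ∀ x ∈ Ioo (0:ℝ) 1,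
      HasDerivAt (fun y => phip p (deriv u y)) (-(cu x * phip p (u x))) x := by
    intro x hx
    refine (hasDerivAt_of_delaySol hG hz hr x hx).congr_deriv ?_
    by_cases h : u x = 0
    · have := hC x 0 z.1
      rw [abs_zero, Real.zero_rpow (by linarith), mul_zero, abs_nonpos_iff] at this
      simp [h, this]
    · simp only [cu]
      rw [div_mul_cancel₀ _ (phip_ne_zero h)]
  have hcu : ∀ x ∈ Ioo (0:ℝ) 1, u x ≠ 0 → |cu x - z.1 * a x| ≤ M + η * a0 / 2 := by
    intro x hx hux
    have h1 := hs x hx (u x) (by rw [← hr.1 ⟨x, Ioo_subset_Icc_self hx⟩]; exact hzδ _) z.1 hzL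
    have h2 : G x (u x) z.1 - z.1 * a x * phip p (u x) = (cu x - z.1 * a x) * phip p (u x) := by
      simp only [cu]
      rw [sub_mul, div_mul_cancel₀ _ (phip_ne_zero hux)]
    rw [h2, abs_mul, ← abs_phip hp] at h1
    exact le_of_mul_le_mul_right h1 (abs_pos.2 (phip_ne_zero hux))
  have hMa : M / a0 * a0 = M := by field_simp
  constructor
  · intro hl
    by_contra! hcon
    have := rotAngle_lt_of_le hp (cu := cu) (cv := fun x => lamk * a x) hu he.1.1 hu0 he.1.2.1
      hr hwe hne hene hw he.2 (fun x hx hux _ => ?_) hk hcon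
    · linarith
    · have h1 := (abs_le.1 (hcu x hx hux)).2
      have h2 : (M / a0 + η) * a0 ≤ (lamk - z.1) * a x :=
        mul_le_mul (by linarith) (ha x hx) ha0.le (by
          have : 0 < M / a0 := by positivity
          linarith)
      have h3 : 0 < η * a0 := by positivity
      nlinarith
  · intro hl
    refine rotAngle_lt_of_le hp (cu := fun x => lamk * a x) (cv := cu) he.1.1 hu he.1.2.1 hu0
      hwe hr hene hne he.2 hw (fun x hx _ hux => ?_) hk herot.ge
    have h1 := (abs_le.1 (hcu x hx hux)).1
    have h2 : (M / a0 + η) * a0 ≤ (z.1 - lamk) * a x :=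
      mul_le_mul (by linarith) (ha x hx) ha0.le (by
        have : 0 < M / a0 := by positivity
        linarith)
    have h3 : 0 < η * a0 := by positivity
    nlinarith

end SmallSolutions

section Correspondence

variable {p : ℝ}

lemma abs_le_hat {u : ℝ → ℝ} (hu : ContDiff ℝ 1 u) (h0 : u 0 = 0) (h1 : u 1 = 0) {R : ℝ}
    (hR : ∀ x ∈ Icc (0:ℝ) 1, |deriv u x| ≤ R) {x : ℝ} (hx : x ∈ Icc (0:ℝ) 1) :
    |u x| ≤ hat R x := by
  have hR0 : 0 ≤ R := (abs_nonneg _).trans (hR 0 (by simp))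
  have key : ∀ y ∈ Icc (0:ℝ) 1, |u y - u x| ≤ R * |y - x| := fun y hy =>
    (convex_Icc (0:ℝ) 1).norm_image_sub_le_of_norm_deriv_le
      (fun t _ => (hu.differentiable one_ne_zero) t) hR hx hy
  have k0 := key 0 (by simp)
  have k1 := key 1 (by simp)
  rw [h0, zero_sub, zero_sub, abs_neg, abs_neg, abs_of_nonneg hx.1] at k0
  rw [h1, zero_sub, abs_neg, abs_of_nonneg (show (0:ℝ) ≤ 1 - x by linarith [hx.2])] at k1
  rw [hat, mul_min_of_nonneg _ _ hR0]
  exact le_min k0 k1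

lemma abs_apply_le_norm (z : Xsp) (x : Icc (0:ℝ) 1) :
    |z.1| ≤ ‖z‖ ∧ |z.2.1 x| ≤ ‖z‖ ∧ |z.2.2 x| ≤ ‖z‖ :=
  ⟨norm_fst_le z, (z.2.1.norm_coe_le_norm x).trans ((norm_fst_le z.2).trans (norm_snd_le z)),
    (z.2.2.norm_coe_le_norm x).trans ((norm_snd_le z.2).trans (norm_snd_le z))⟩

lemma ReprE.abs_deriv_le {u : ℝ → ℝ} {z : Xsp} (hr : ReprE u z.2) {R : ℝ} (hz : ‖z‖ ≤ R) :
    ∀ x ∈ Icc (0:ℝ) 1, |deriv u x| ≤ R := fun x hx => by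
  rw [← hr.2 ⟨x, hx⟩]
  exact (abs_apply_le_norm z _).2.2.trans hz

lemma mem_delaySol_of_isSolFG (hp : 1 < p) {a : ℝ → ℝ} {f g : ℝ → ℝ → ℝ → ℝ}
    {G : ℝ → ℝ → ℝ → ℝ} (hG : Continuous fun q : ℝ × ℝ × ℝ => G q.1 q.2.1 q.2.2) {R : ℝ}
    (hGe : ∀ x ∈ Ioo (0:ℝ) 1, ∀ s, |s| ≤ hat R x → ∀ l, |l| ≤ R →
        G x s l = l * a x * phip p s + (f x s l + g x s l))
    {z : Xsp} (hz : ‖z‖ ≤ R) {u : ℝ → ℝ} (hu : IsSolFG p a f g z.1 u) (hr : ReprE u z.2) :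
    z ∈ delaySol p G 0 := by
  refine mem_delaySol_of_hasDerivAt hp hG hu.1.1 hu.1.2.1 hr fun x hx => ?_
  rw [hGe x hx _ (abs_le_hat hu.1.1 hu.1.2.1 hu.1.2.2 (hr.abs_deriv_le hz) (Ioo_subset_Icc_self hx))
    _ ((abs_apply_le_norm z 0).1.trans hz), ← add_assoc]
  exact hu.2 x hx

lemma MemS.nontriv {k : ℕ} {ν : ℝ} {u : ℝ → ℝ} (hu : MemS k ν u) : Nontriv u := by
  obtain ⟨-, -, -, -, δ, hδ, h⟩ := hu
  have h1 : min (δ / 2) 1 < δ := (min_le_left _ _).trans_lt (by linarith)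
  refine ⟨min (δ / 2) 1, ⟨by positivity, min_le_right _ _⟩, fun h0 => ?_⟩
  have := h (min (δ / 2) 1) ⟨by positivity, h1⟩
  rw [h0, mul_zero] at this
  exact lt_irrefl _ this

lemma exists_memS_of_delaySol (hp : 1 < p) {G : ℝ → ℝ → ℝ → ℝ} {z : Xsp}
    (hz : z ∈ delaySol p G 0) {k : ℕ} (hk : 1 ≤ k) {ν : ℝ} (hν : 0 < ν * z.2.2 0)
    (hne : ∀ x, phaseCurve hp z.2 x ≠ 0) (hrot : rotAngle (phaseCurve hp z.2) = k * Real.pi) :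
    ∃ u, MemS k ν u ∧ ReprE u z.2 := by
  obtain ⟨u, hu, hu0, hr, -⟩ := exists_reprE_of_delaySol hz
  refine ⟨u, memS_of_rotAngle_eq hp hk hu hu0 ?_ hr hne hrot, hr⟩
  have := hr.2 0
  rw [Icc.coe_zero] at this
  rwa [← this]

lemma isSolFG_of_delaySol {a : ℝ → ℝ} {f g : ℝ → ℝ → ℝ → ℝ}
    {G : ℝ → ℝ → ℝ → ℝ} (hG : Continuous fun q : ℝ × ℝ × ℝ => G q.1 q.2.1 q.2.2) {R : ℝ}
    (hGe : ∀ x ∈ Ioo (0:ℝ) 1, ∀ s, |s| ≤ hat R x → ∀ l, |l| ≤ R →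
        G x s l = l * a x * phip p s + (f x s l + g x s l))
    {z : Xsp} (hz : ‖z‖ ≤ R) (hzG : z ∈ delaySol p G 0) {u : ℝ → ℝ} (hu : MemE u)
    (hr : ReprE u z.2) : IsSolFG p a f g z.1 u := by
  refine ⟨hu, fun x hx => ?_⟩
  rw [add_assoc, ← hGe x hx _ (abs_le_hat hu.1 hu.2.1 hu.2.2 (hr.abs_deriv_le hz)
    (Ioo_subset_Icc_self hx)) _ ((abs_apply_le_norm z 0).1.trans hz)]
  exact hasDerivAt_of_delaySol hG hzG hr x hx

end Correspondence

section Assembly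

variable {p : ℝ}

/-- In a compact set, a component contained in an open set can be separated from the complement of
the open set. -/
lemma exists_isCompact_separation {X : Type*} [TopologicalSpace X] [T2Space X] {A O : Set X}
    (hA : IsCompact A) {c : X} (hc : c ∈ A) (hO : IsOpen O)
    (h : connectedComponentIn A c ⊆ O) :
    ∃ K₀ K₁ : Set X, IsCompact K₀ ∧ IsCompact K₁ ∧ K₀ ∪ K₁ = A ∧ Disjoint K₀ K₁ ∧ K₀ ⊆ O ∧
      connectedComponentIn A c ⊆ K₀ := by
  have : CompactSpace A := isCompact_iff_compactSpace.1 hA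
  rw [connectedComponentIn_eq_image hc] at h ⊢
  have h1 : connectedComponent (⟨c, hc⟩ : A) ⊆ Subtype.val ⁻¹' O := image_subset_iff.1 h
  have hsub := h1
  rw [connectedComponent_eq_iInter_isClopen] at h1
  have : Nonempty { s : Set A // IsClopen s ∧ (⟨c, hc⟩ : A) ∈ s } :=
    ⟨⟨univ, isClopen_univ, mem_univ _⟩⟩
  obtain ⟨⟨U, hU, hcU⟩, hUO⟩ := exists_subset_nhds_of_compactSpace
    (V := fun s : { s : Set A // IsClopen s ∧ (⟨c, hc⟩ : A) ∈ s } => (s : Set A))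
    (fun s t => ⟨⟨s ∩ t, s.2.1.inter t.2.1, s.2.2, t.2.2⟩, inter_subset_left, inter_subset_right⟩)
    (fun s => s.2.1.isClosed)
    (fun x hx => (hO.preimage continuous_subtype_val).mem_nhds (h1 hx))
  refine ⟨(↑) '' U, (↑) '' Uᶜ, hU.isClosed.isCompact.image continuous_subtype_val,
    hU.compl.isClosed.isCompact.image continuous_subtype_val, ?_, ?_, image_subset_iff.2 hUO, ?_⟩
  · rw [← image_union, union_compl_self, image_univ, Subtype.range_coe]
  · exact (disjoint_image_iff Subtype.val_injective).2 disjoint_compl_right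
  · exact image_mono (hU.connectedComponent_subset hcU)

/-- Solvability with prescribed rotation on the zero set of a function `ψ` which is negative near
the trivial solutions with parameter in `[m₁, m₂]` and positive far away. -/
lemma exists_delaySol_rotAngle_eq (hp : 1 < p) {G : ℝ → ℝ → ℝ → ℝ}
    (hG : Continuous fun q : ℝ × ℝ × ℝ => G q.1 q.2.1 q.2.2) {K C : ℝ}
    (hK : ∀ x s l, |G x s l| ≤ K) (hC : ∀ x s l, |G x s l| ≤ C * |s| ^ (p - 1))
    {ν : ℝ} (hν : |ν| = 1) {k : ℕ} {R α m₁ m₂ : ℝ} (hα : 0 < α) (hαR : α ≤ R)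
    (hm₁ : -R ≤ m₁) (hm : m₁ ≤ m₂) (hm₂ : m₂ ≤ R) {ψ : Xsp → ℝ} (hψ : Continuous ψ)
    (hψR : ∀ z, R ≤ ‖z‖ → 0 < ψ z)
    (h₁ : ∀ z ∈ delaySol p G 0, z.1 ∈ Icc (-R) m₁ → ν * z.2.2 0 = α →
      rotAngle (phaseCurve hp z.2) < k * Real.pi)
    (h₂ : ∀ z ∈ delaySol p G 0, z.1 ∈ Icc m₁ m₂ → ν * z.2.2 0 = α → ψ z < 0)
    (h₃ : ∀ z ∈ delaySol p G 0, z.1 ∈ Icc m₂ R → ν * z.2.2 0 = α →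
      k * Real.pi < rotAngle (phaseCurve hp z.2)) :
    ∃ z ∈ delaySol p G 0, 0 < ν * z.2.2 0 ∧ rotAngle (phaseCurve hp z.2) = k * Real.pi ∧
      ψ z = 0 := by
  by_contra! hcon
  have hνν : ν * ν = 1 := by rw [← abs_mul_abs_self, hν, one_mul]
  have habs : ∀ {b : ℝ}, 0 < ν * b → |b| = ν * b := fun {b} hb => by
    rw [← abs_of_pos hb, abs_mul, hν, one_mul]
  have hne : ∀ z ∈ delaySol p G 0, 0 < ν * z.2.2 0 → ∀ x, phaseCurve hp z.2 x ≠ 0 := by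
    intro z hz hz0
    refine phaseCurve_ne_zero_of_delaySol hp hG hC hz fun h => ?_
    simp [h] at hz0
  let Q : Set (ℝ × ℝ) → Set (ℝ × ℝ) := fun T => (fun q => (q.1, ν * q.2)) ⁻¹' T
  have hQ : ∀ {T}, IsClosed T → IsClosed (Q T) := fun hT => hT.preimage (by fun_prop)
  have hQL : ∀ {T}, T ⊆ Icc (-R) R ×ˢ Icc α R → ∀ q ∈ Q T, |q.1| ≤ R ∧ |q.2| ≤ R := by
    intro T hT q hq
    obtain ⟨h1, h2, h3⟩ := hT hq
    refine ⟨abs_le.2 h1, ?_⟩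
    rw [habs (hα.trans_le h2)]
    exact h3
  obtain ⟨ε₁, hε₁, H₁⟩ := exists_forall_delaySol_mem hp hG hK
    (Q := Q (Icc (-R) m₁ ×ˢ Icc α α)) (hQ (isClosed_Icc.prod isClosed_Icc))
    (hQL (prod_mono (Icc_subset_Icc_right (hm.trans hm₂)) (Icc_subset_Icc_right hαR)))
    (isOpen_rotAngle_mem hp (isOpen_Iio (a := (k * Real.pi : ℝ)))) (fun z hz hzQ =>
      ⟨hne z hz (hα.trans_le hzQ.2.1), h₁ z hz hzQ.1 (le_antisymm hzQ.2.2 hzQ.2.1)⟩)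
  obtain ⟨ε₂, hε₂, H₂⟩ := exists_forall_delaySol_mem hp hG hK
    (Q := Q (Icc m₁ m₂ ×ˢ Icc α α)) (hQ (isClosed_Icc.prod isClosed_Icc))
    (hQL (prod_mono (Icc_subset_Icc hm₁ hm₂) (Icc_subset_Icc_right hαR)))
    (isOpen_Iio.preimage hψ) (fun z hz hzQ => h₂ z hz hzQ.1 (le_antisymm hzQ.2.2 hzQ.2.1))
  obtain ⟨ε₃, hε₃, H₃⟩ := exists_forall_delaySol_mem hp hG hK
    (Q := Q (Icc m₂ R ×ˢ Icc α α)) (hQ (isClosed_Icc.prod isClosed_Icc))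
    (hQL (prod_mono (Icc_subset_Icc_left (hm₁.trans hm)) (Icc_subset_Icc_right hαR)))
    (isOpen_rotAngle_mem hp (isOpen_Ioi (a := (k * Real.pi : ℝ)))) (fun z hz hzQ =>
      ⟨hne z hz (hα.trans_le hzQ.2.1), h₃ z hz hzQ.1 (le_antisymm hzQ.2.2 hzQ.2.1)⟩)
  obtain ⟨ε₄, hε₄, H₄⟩ := exists_forall_delaySol_mem hp hG hK
    (Q := Q (Icc (-R) R ×ˢ Icc α R)) (hQ (isClosed_Icc.prod isClosed_Icc)) (hQL subset_rfl)
    ((isOpen_phaseCurve_ne_zero hp).inter ((isOpen_rotAngle_mem hp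
      (isOpen_compl_singleton (x := (k * Real.pi : ℝ)))).union
      (isOpen_compl_singleton.preimage hψ (t := {(0:ℝ)}ᶜ)))) (fun z hz hzQ => by
        have hz0 := hα.trans_le hzQ.2.1
        refine ⟨hne z hz hz0, ?_⟩
        by_cases h : rotAngle (phaseCurve hp z.2) = k * Real.pi
        · exact Or.inr (hcon z hz hz0 h)
        · exact Or.inl ⟨hne z hz hz0, h⟩)
  let h := min (min ε₁ ε₂) (min ε₃ ε₄) / 2
  have hm0 : 0 < min (min ε₁ ε₂) (min ε₃ ε₄) := by positivity
  have hh : 0 < h := half_pos hm0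
  have hlt : h < min (min ε₁ ε₂) (min ε₃ ε₄) := half_lt_self hm0
  obtain ⟨⟨hl₁, hl₂⟩, hl₃, hl₄⟩ : (h < ε₁ ∧ h < ε₂) ∧ h < ε₃ ∧ h < ε₄ := by
    simpa only [lt_min_iff] using hlt
  obtain ⟨Z, hZ, hZ'⟩ := exists_continuous_delaySol hG hp hh
  let W : ℝ × ℝ → Xsp := fun q => Z (q.1, ν * q.2)
  have hW : Continuous W := hZ.comp (by fun_prop)
  have hWs : ∀ q, W q ∈ delaySol p G h := fun q => (hZ' _).2.2
  have hW1 : ∀ q, (W q).1 = q.1 := fun q => (hZ' _).1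
  have hW2 : ∀ q, (W q).2.2 0 = ν * q.2 := fun q => (hZ' _).2.1
  have hWQ : ∀ {T : Set (ℝ × ℝ)} {q}, q ∈ T → ((W q).1, (W q).2.2 0) ∈ Q T := by
    intro T q hq
    simp only [Q, mem_preimage]
    rwa [hW1, hW2, ← mul_assoc, hνν, one_mul]
  have hWne : ∀ q ∈ Icc (-R) R ×ˢ Icc α R, ∀ x, phaseCurve hp (W q).2 x ≠ 0 := fun q hq =>
    (H₄ h hh.le hl₄ _ (hWs q) (hWQ hq)).1
  have hR : 0 ≤ R := hα.le.trans hαR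
  have hfar : ∀ q : ℝ × ℝ, R ≤ |q.1| ∨ R ≤ |q.2| → 0 < ψ (W q) := by
    rintro q (hq | hq)
    · exact hψR _ (hq.trans ((hW1 q ▸ (abs_apply_le_norm (W q) 0).1)))
    · have := (abs_apply_le_norm (W q) 0).2.2
      rw [hW2, abs_mul, hν, one_mul] at this
      exact hψR _ (hq.trans this)
  have hαα : α ∈ Icc α α := ⟨le_rfl, le_rfl⟩
  obtain ⟨q, hq, hq1, hq2⟩ := exists_common_zero_rect
    (h := fun q => rotAngle (phaseCurve hp (W q).2) - k * Real.pi) (ψ := fun q => ψ (W q))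
    hm₁ hm hm₂ hαR (fun q hq => by
      have hc : ContinuousAt (fun q => phaseCurve hp (W q).2) q :=
        ((continuous_phaseCurve hp).comp (continuous_snd.comp hW)).continuousAt
      exact ((ContinuousAt.comp (f := fun q => phaseCurve hp (W q).2)
        (continuousAt_rotAngle (hWne q hq)) hc).sub
        continuousAt_const).continuousWithinAt)
    (hψ.comp hW).continuousOn
    (fun y _ => hfar _ (Or.inl (by simp [abs_of_nonneg hR])))
    (fun y _ => hfar _ (Or.inl (by simp [abs_of_nonneg hR])))
    (fun x _ => hfar _ (Or.inr (by simp [abs_of_nonneg hR])))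
    (fun x hx => sub_neg.2 (H₁ h hh.le hl₁ _ (hWs (x, α)) (hWQ ⟨hx, hαα⟩)).2)
    (fun x hx => H₂ h hh.le hl₂ _ (hWs (x, α)) (hWQ ⟨hx, hαα⟩))
    (fun x hx => sub_pos.2 (H₃ h hh.le hl₃ _ (hWs (x, α)) (hWQ ⟨hx, hαα⟩)).2)
  rcases (H₄ h hh.le hl₄ _ (hWs q) (hWQ hq)).2 with h | h
  · exact h.2 (sub_eq_zero.1 hq1)
  · exact h hq2

/-- A nonlinearity bounded by `(M + o(1)) |s|^(p-1)` as `s → 0`. -/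
lemma exists_forall_abs_add_le (hp : 1 < p) {f g : ℝ → ℝ → ℝ → ℝ} {M : ℝ}
    (hC1 : ∀ x ∈ Ioo (0:ℝ) 1, ∀ s : ℝ, 0 < |s| → |s| ≤ 1 → ∀ lam : ℝ,
      |f x s lam| ≤ M * |phip p s|)
    (hC2 : ∀ C > (0:ℝ), ∀ ε > (0:ℝ), ∃ δ > (0:ℝ), ∀ x ∈ Ioo (0:ℝ) 1, ∀ s : ℝ,
      0 < |s| → |s| < δ → ∀ lam : ℝ, |lam| ≤ C → |g x s lam| ≤ ε * |s| ^ (p - 1))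
    {L : ℝ} (hL : 0 < L) : ∀ η > 0, ∃ δ > 0, ∀ x ∈ Ioo (0:ℝ) 1, ∀ s, 0 < |s| → |s| < δ →
      ∀ l, |l| ≤ L → |f x s l + g x s l| ≤ (M + η) * |s| ^ (p - 1) := by
  intro η hη
  obtain ⟨δ, hδ, h⟩ := hC2 L hL η hη
  refine ⟨min δ 1, by positivity, fun x hx s hs hsδ l hl => ?_⟩
  have h1 := hC1 x hx s hs (hsδ.le.trans (min_le_right _ _)) l
  have h2 := h x hx s hs (hsδ.trans_le (min_le_left _ _)) l hl
  rw [abs_phip hp] at h1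
  rw [add_mul]
  exact (abs_add_le _ _).trans (add_le_add h1 h2)

end Assembly

section Closure

variable {p : ℝ}

lemma MemS.phaseCurve_pos (hp : 1 < p) {k : ℕ} (hk : 1 ≤ k) {ν : ℝ} (hν : ν = 1 ∨ ν = -1)
    {u : ℝ → ℝ} (hu : MemS k ν u) {w : CI × CI} (hw : ReprE u w) :
    rotAngle (phaseCurve hp w) = k * Real.pi ∧ 0 < ν * w.2 0 := by
  refine ⟨hu.rotAngle_eq hp hk hw, ?_⟩
  rw [hw.2 0, Icc.coe_zero]
  exact hu.deriv_pos hν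

/-- Limits of nodal solutions are nodal, or trivial with parameter in `I_k`. -/
lemma memS_or_of_mem_closure (hp : 1 < p) {G : ℝ → ℝ → ℝ → ℝ}
    (hG : Continuous fun q : ℝ × ℝ × ℝ => G q.1 q.2.1 q.2.2) {C : ℝ}
    (hC : ∀ x s l, |G x s l| ≤ C * |s| ^ (p - 1)) {k : ℕ} (hk : 1 ≤ k) {ν : ℝ}
    (hν : ν = 1 ∨ ν = -1) {L b c : ℝ}
    (hrot : ∀ η > 0, ∃ δ > 0, ∀ z ∈ delaySol p G 0, z.2 ≠ 0 → |z.1| ≤ L →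
      (∀ x, |z.2.1 x| ≤ δ) → (z.1 ≤ b - η → rotAngle (phaseCurve hp z.2) < k * Real.pi) ∧
      (c + η ≤ z.1 → k * Real.pi < rotAngle (phaseCurve hp z.2)))
    {B : Set Xsp} (hBG : B ⊆ delaySol p G 0) (hBS : ∀ z ∈ B, ∃ u, MemS k ν u ∧ ReprE u z.2)
    (hBL : ∀ z ∈ B, |z.1| ≤ L) {z : Xsp} (hz : z ∈ closure B) :
    (∃ u, MemS k ν u ∧ ReprE u z.2) ∨ z ∈ Icc b c ×ˢ {(0 : CI × CI)} := by
  have hzG : z ∈ delaySol p G 0 := closure_minimal hBG (isClosed_delaySol_zero hp hG) hz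
  have hB : ∀ y ∈ B, rotAngle (phaseCurve hp y.2) = k * Real.pi ∧ 0 < ν * y.2.2 0 := by
    intro y hy
    obtain ⟨u, hu, hr⟩ := hBS y hy
    exact hu.phaseCurve_pos hp hk hν hr
  by_cases h0 : z.2 = 0
  · right
    refine ⟨?_, h0⟩
    have key : ∀ η > 0, ∃ y ∈ B, |y.1 - z.1| < η ∧ ¬ y.1 ≤ b - η ∧ ¬ c + η ≤ y.1 := by
      intro η hη
      obtain ⟨δ, hδ, h⟩ := hrot η hη
      obtain ⟨y, hy, hzy⟩ := Metric.mem_closure_iff.1 hz (min η δ) (by positivity)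
      rw [dist_comm, dist_eq_norm] at hzy
      have hyη : |y.1 - z.1| ≤ ‖y - z‖ := norm_fst_le (y - z)
      have hyδ : ‖y.2‖ ≤ ‖y - z‖ := by simpa [h0] using norm_snd_le (y - z)
      have hy0 : y.2 ≠ 0 := fun h => by
        have := (hB y hy).2
        simp [h] at this
      have h' := h y (hBG hy) hy0 (hBL y hy) fun x =>
        ((y.2.1.norm_coe_le_norm x).trans ((norm_fst_le y.2).trans hyδ)).trans
          (hzy.le.trans (min_le_right _ _))
      exact ⟨y, hy, hyη.trans_lt (hzy.trans_le (min_le_left _ _)),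
        fun hl => (h'.1 hl).ne (hB y hy).1, fun hl => (h'.2 hl).ne' (hB y hy).1⟩
    constructor <;> refine le_of_forall_pos_lt_add fun η hη => ?_ <;>
      obtain ⟨y, -, h1, h2, h3⟩ := key (η / 2) (by positivity) <;>
      linarith [abs_lt.1 h1, (abs_lt.1 h1).1, (abs_lt.1 h1).2]
  · left
    have hne := phaseCurve_ne_zero_of_delaySol hp hG hC hzG h0
    have hν0 : 0 ≤ ν * z.2.2 0 := closure_minimal (t := {y : Xsp | 0 ≤ ν * y.2.2 0})
      (fun y hy => (hB y hy).2.le) (isClosed_le continuous_const (by fun_prop)) hz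
    refine exists_memS_of_delaySol hp hzG hk (hν0.lt_of_ne' fun h => h0 ?_) hne ?_
    · refine eq_zero_of_delaySol hp hG hC hzG ((mul_eq_zero.1 h).resolve_left ?_)
      rcases hν with rfl | rfl <;> norm_num
    · by_contra hr
      obtain ⟨y, hy, hyB⟩ := mem_closure_iff.1 hz _
        (isOpen_rotAngle_mem hp (isOpen_compl_singleton (x := (k * Real.pi : ℝ)))) ⟨hne, hr⟩
      exact hy.2 (hB y hyB).1

/-- A neighbourhood of a compact interval contains a slightly larger closed interval. -/
lemma exists_Icc_subset_of_isOpen {b c : ℝ} (hbc : b ≤ c) {O : Set ℝ} (hO : IsOpen O)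
    (h : Icc b c ⊆ O) : ∃ η > 0, Icc (b - η) (c + η) ⊆ O := by
  obtain ⟨δ, hδ, hs⟩ := isCompact_Icc.exists_cthickening_subset_open hO h
  refine ⟨δ, hδ, fun x hx => hs ?_⟩
  rw [isCompact_Icc.cthickening_eq_biUnion_closedBall hδ.le]
  simp only [mem_iUnion, Real.closedBall_eq_Icc]
  refine ⟨max b (min x c), ⟨le_max_left _ _, max_le hbc (min_le_right _ _)⟩, ?_⟩
  rw [mem_Icc] at hx ⊢
  grind

end Closure

/-- **Theorem 1.1**: unilateral global bifurcation from the interval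
`I_k = [λ_k - M/a_0, λ_k + M/a_0]`. -/
theorem stmt0 (p : ℝ) (hp : 1 < p)
    (a : ℝ → ℝ) (ha : ContinuousOn a (Icc 0 1)) (hapos : ∀ x ∈ Icc (0:ℝ) 1, 0 < a x)
    (f g : ℝ → ℝ → ℝ → ℝ)
    (hf : ContinuousOn (fun q : ℝ × ℝ × ℝ => f q.1 q.2.1 q.2.2)
      (Ioo (0:ℝ) 1 ×ˢ (univ : Set (ℝ × ℝ))))
    (hg : ContinuousOn (fun q : ℝ × ℝ × ℝ => g q.1 q.2.1 q.2.2)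
      (Ioo (0:ℝ) 1 ×ˢ (univ : Set (ℝ × ℝ))))
    (M : ℝ) (hM : 0 < M)
    -- (C1)
    (hC1 : ∀ x ∈ Ioo (0:ℝ) 1, ∀ s : ℝ, 0 < |s| → |s| ≤ 1 → ∀ lam : ℝ,
      |f x s lam| ≤ M * |phip p s|)
    -- (C2): g = o(|s|^{p-1}) at s = 0, uniformly in x and on bounded λ intervals
    (hC2 : ∀ C > (0:ℝ), ∀ ε > (0:ℝ), ∃ δ > (0:ℝ), ∀ x ∈ Ioo (0:ℝ) 1, ∀ s : ℝ,
      0 < |s| → |s| < δ → ∀ lam : ℝ, |lam| ≤ C → |g x s lam| ≤ ε * |s| ^ (p - 1))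
    -- a0 = min a on [0,1]
    (a0 : ℝ) (ha0 : IsLeast (a '' Icc 0 1) a0)
    (k : ℕ) (hk : 1 ≤ k) (ν : ℝ) (hν : ν = 1 ∨ ν = -1)
    -- λ_k : the k-th eigenvalue of the linear problem
    (lamk : ℝ) (hlamk : ∃ u, IsLinSol p a lamk u ∧ MemS k 1 u) :
    -- the interval I_k × {0}
    let Ik0 : Set Xsp := Icc (lamk - M / a0) (lamk + M / a0) ×ˢ {(0 : CI × CI)}
    -- 𝒮 : closure of the set of nontrivial solutions; 𝒮_k^ν its part with u ∈ S_k^ν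
    let SolX : Set Xsp := {z | ∃ u, IsSolFG p a f g z.1 u ∧ Nontriv u ∧ ReprE u z.2}
    let SkX : Set Xsp := {z | ∃ u, MemS k ν u ∧ ReprE u z.2}
    let A : Set Xsp := (closure SolX ∩ SkX) ∪ Ik0
    -- 𝒟_k^ν : the component of 𝒮_k^ν ∪ (I_k × {0}) containing I_k × {0}
    let D : Set Xsp := connectedComponentIn A (lamk, 0)
    Ik0 ⊆ D ∧ ¬ Bornology.IsBounded D ∧ D ⊆ SkX ∪ Ik0 := by
  intro Ik0 SolX SkX A D
  obtain ⟨x₀, hx₀, hax₀⟩ := ha0.1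
  have ha0pos : 0 < a0 := hax₀ ▸ hapos x₀ hx₀
  have ha0le : ∀ x ∈ Ioo (0:ℝ) 1, a0 ≤ a x := fun x hx =>
    ha0.2 ⟨x, Ioo_subset_Icc_self hx, rfl⟩
  obtain ⟨e, he, heS⟩ := hlamk
  have hd : 0 < M / a0 := by positivity
  have hc0 : ((lamk, 0) : Xsp) ∈ Ik0 := ⟨⟨by linarith, by linarith⟩, rfl⟩
  have hI : Ik0 ⊆ D := (isPreconnected_Icc.prod isPreconnected_singleton).subset_connectedComponentIn
    hc0 subset_union_right
  have hDA : D ⊆ A := connectedComponentIn_subset _ _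
  refine ⟨hI, fun hb => ?_, hDA.trans (union_subset_union_left _ inter_subset_right)⟩
  obtain ⟨R, hR, hDR⟩ := hb.subset_ball_lt 0 0
  have hDR' : ∀ z ∈ D, ‖z‖ < R := fun z hz => by simpa using hDR hz
  -- a globally defined bounded nonlinearity, unchanged on the ball of radius `R + 1`
  obtain ⟨G, hG, ⟨K, hK⟩, ⟨C, hC⟩, hGs, hGe⟩ := exists_truncation hp ha (hf.add hg) hM
    (show 0 < R + 1 by positivity) (show 0 ≤ R + 1 by positivity)
    (exists_forall_abs_add_le hp hC1 hC2 (by positivity))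
  have hrot := fun η hη => exists_forall_rotAngle hp hG hC hM ha0pos ha0le hGs hk he heS (η := η) hη
  have hSolG : ∀ z ∈ closure SolX, ‖z‖ ≤ R → z ∈ delaySol p G 0 := by
    intro z hz hzR
    have h1 : z ∈ closure (Metric.ball 0 (R + 1) ∩ SolX) :=
      Metric.isOpen_ball.inter_closure ⟨by rw [mem_ball_zero_iff]; linarith, hz⟩
    refine closure_minimal ?_ (isClosed_delaySol_zero hp hG) h1
    rintro y ⟨hy, u, hu, -, hr⟩
    exact mem_delaySol_of_isSolFG hp hG hGe (mem_ball_zero_iff.1 hy).le hu hr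
  -- the part of `A` in the ball of radius `R` is compact
  let B : Set Xsp := (closure SolX ∩ SkX) ∩ Metric.closedBall 0 R
  have hBR : ∀ z ∈ B, ‖z‖ ≤ R := fun z hz => mem_closedBall_zero_iff.1 hz.2
  have hBG : B ⊆ delaySol p G 0 := fun z hz => hSolG z hz.1.1 (hBR z hz)
  have hBL : ∀ z ∈ B, |z.1| ≤ R := fun z hz => (abs_apply_le_norm z 0).1.trans (hBR z hz)
  have hIc : IsCompact Ik0 := isCompact_Icc.prod isCompact_singleton
  have hclB : closure B ∪ Ik0 = B ∪ Ik0 := by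
    refine (union_subset (fun z hz => ?_) subset_union_right).antisymm
      (union_subset_union_left _ subset_closure)
    rcases memS_or_of_mem_closure hp hG hC hk hν hrot hBG (fun z hz => hz.1.2)
      (fun z hz => (hBL z hz).trans (by linarith)) hz with h | h
    · refine Or.inl ⟨⟨?_, h⟩, closure_minimal inter_subset_right Metric.isClosed_closedBall hz⟩
      exact closure_minimal (fun y hy => hy.1.1) isClosed_closure hz
    · exact Or.inr h
  have hcomp : IsCompact (B ∪ Ik0) := by
    obtain ⟨S, hS, hS'⟩ := exists_isCompact_delaySol hp hG hK R
    rw [← hclB]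
    exact (hS.closure_of_subset fun z hz => hS' 0 z (hBG hz) (hBL z hz)
      ((abs_apply_le_norm z 0).2.2.trans (hBR z hz))).union hIc
  have hsubA : B ∪ Ik0 ⊆ A := union_subset_union_left _ inter_subset_left
  have hsubD : connectedComponentIn (B ∪ Ik0) (lamk, 0) ⊆ D := connectedComponentIn_mono _ hsubA
  obtain ⟨K₀, K₁, hK₀, hK₁, hKB, hdisj, hK₀R, hcK₀⟩ := exists_isCompact_separation hcomp
    (Or.inr hc0) (Metric.isOpen_ball (x := 0) (ε := R)) (hsubD.trans hDR)
  have hIK₀ : Ik0 ⊆ K₀ :=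
    ((isPreconnected_Icc.prod isPreconnected_singleton).subset_connectedComponentIn hc0
      subset_union_right).trans hcK₀
  -- a function separating the two pieces
  obtain ⟨φ, hφ0, hφ1, -⟩ := exists_continuous_zero_one_of_isClosed hK₀.isClosed
    (hK₁.isClosed.union (isClosed_le continuous_const continuous_norm :
      IsClosed {z : Xsp | R ≤ ‖z‖})) (by
      rw [disjoint_union_right]
      refine ⟨hdisj, disjoint_left.2 fun z hz hzR => ?_⟩
      exact (mem_ball_zero_iff.1 (hK₀R hz)).not_ge hzR)
  let ψ : Xsp → ℝ := fun z => 2 * φ z - 1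
  have hψ : Continuous ψ := by fun_prop
  have hψ0 : ∀ z ∈ K₀, ψ z = -1 := fun z hz => by simp [ψ, hφ0 hz]
  have hψ1 : ∀ z, z ∈ K₁ ∨ R ≤ ‖z‖ → ψ z = 1 := fun z hz => by
    simp only [ψ, hφ1 hz, Pi.one_apply]; norm_num
  obtain ⟨η, hη, hηs⟩ := exists_Icc_subset_of_isOpen (b := lamk - M / a0) (c := lamk + M / a0)
    (by linarith) (O := (fun l : ℝ => ψ (l, 0)) ⁻¹' Iio 0) (isOpen_Iio.preimage (by fun_prop))
    (fun l hl => by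
      have hl0 : ((l, 0) : Xsp) ∈ Ik0 := ⟨hl, rfl⟩
      rw [mem_preimage, hψ0 _ (hIK₀ hl0)]
      norm_num)
  set m₁ := lamk - M / a0 - η with hm₁
  set m₂ := lamk + M / a0 + η with hm₂
  have hIcc : ∀ l ∈ Icc m₁ m₂, |l| < R := by
    intro l hl
    by_contra! h
    have h1 : ψ (l, 0) < 0 := hηs hl
    rw [hψ1 _ (Or.inr (h.trans (abs_apply_le_norm ((l, 0) : Xsp) 0).1))] at h1
    linarith
  have hmm : m₁ ≤ m₂ := by linarith
  have hm₁R := (abs_lt.1 (hIcc m₁ ⟨le_rfl, hmm⟩)).1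
  have hm₂R := (abs_lt.1 (hIcc m₂ ⟨hmm, le_rfl⟩)).2
  obtain ⟨δ, hδ, hδs⟩ := hrot η hη
  obtain ⟨α₁, hα₁, h₁⟩ := exists_forall_mem_of_slope_le hp hG hK hC (b := m₁) (c := m₂)
    (isOpen_Iio.preimage hψ) fun l hl => hηs hl
  obtain ⟨α₂, hα₂, h₂⟩ := exists_forall_mem_of_slope_le hp hG hK hC (b := -R) (c := R)
    (O := {z : Xsp | ‖z.2‖ < δ}) (isOpen_lt (by fun_prop) continuous_const)
    fun l _ => by simpa using hδ
  let α := min (min α₁ α₂) R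
  have hα : 0 < α := by positivity
  have hα1 : α ≤ α₁ := (min_le_left _ _).trans (min_le_left _ _)
  have hα2 : α ≤ α₂ := (min_le_left _ _).trans (min_le_right _ _)
  have hν1 : |ν| = 1 := by rcases hν with rfl | rfl <;> simp
  have habs : ∀ {b : ℝ}, ν * b = α → |b| = α := fun {b} hb => by
    rw [← abs_of_pos hα, ← hb, abs_mul, hν1, one_mul]
  have hsm : ∀ z ∈ delaySol p G 0, z.1 ∈ Icc (-R) R → ν * z.2.2 0 = α →
      (z.1 ≤ m₁ → rotAngle (phaseCurve hp z.2) < k * Real.pi) ∧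
      (m₂ ≤ z.1 → k * Real.pi < rotAngle (phaseCurve hp z.2)) := by
    intro z hz hzR hzα
    have hzδ : ‖z.2‖ < δ := h₂ z hz hzR ((habs hzα).le.trans hα2)
    refine hδs z hz (fun h => ?_) ((abs_le.2 hzR).trans (by linarith)) fun x =>
      ((z.2.1.norm_coe_le_norm x).trans (norm_fst_le z.2)).trans hzδ.le
    simp [h] at hzα
    exact hα.ne hzα
  obtain ⟨z, hzG, hzν, hzrot, hzψ⟩ := exists_delaySol_rotAngle_eq hp hG hK hC hν1 (k := k) hα
    (min_le_right _ _) hm₁R.le hmm hm₂R.le hψ (fun z hz => by rw [hψ1 z (Or.inr hz)]; norm_num)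
    (fun z hz hzI hzα => (hsm z hz ⟨hzI.1, hzI.2.trans (hmm.trans hm₂R.le)⟩ hzα).1 hzI.2)
    (fun z hz hzI hzα => h₁ z hz hzI ((habs hzα).le.trans hα1))
    (fun z hz hzI hzα => (hsm z hz ⟨(hm₁R.le.trans hmm).trans hzI.1, hzI.2⟩ hzα).2 hzI.1)
  -- the solution found lies in `A` but in neither of the two pieces
  have hzR : ‖z‖ < R := by
    by_contra! h
    rw [hψ1 z (Or.inr h)] at hzψ
    exact one_ne_zero hzψ
  have hz0 : z.2 ≠ 0 := fun h => by simp [h] at hzν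
  obtain ⟨u, hu, hr⟩ := exists_memS_of_delaySol hp hzG hk hzν
    (phaseCurve_ne_zero_of_delaySol hp hG hC hzG hz0) hzrot
  have hzSol : z ∈ SolX := ⟨u, isSolFG_of_delaySol hG hGe (hzR.le.trans (by linarith)) hzG hu.1 hr,
    hu.nontriv, hr⟩
  have hzA : z ∈ B ∪ Ik0 :=
    Or.inl ⟨⟨subset_closure hzSol, u, hu, hr⟩, mem_closedBall_zero_iff.2 hzR.le⟩
  rw [← hKB] at hzA
  rcases hzA with h | h
  · rw [hψ0 z h] at hzψ
    norm_num at hzψ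
  · rw [hψ1 z (Or.inl h)] at hzψ
    exact one_ne_zero hzψ
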